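/- There exist complex coefficients J_{λ,μ} (λ, μ ∈ P), nonzero only when μ ⪯ λ, such that (𝒥f)(λ) = ∑_{μ ∈ P, μ ⪯ λ} J_{λ,μ} f(μ) for all f ∈ 𝒞(P) and λ ∈ P, and the diagonal coefficient is J_{λ,λ} = t[λ]⁻¹. Here for each λ ∈ P the set {μ ∈ P : μ ⪯ λ} is finite, so the sum is finite. -/

import Mathlib

noncomputable section

open scoped RealInnerProductSpace BigOperators Classical
open Filter

namespace AffinePieri

variable {V : Type*} [NormedAddCommGroup V] [InnerProductSpace ℝ V] [FiniteDimensional ℝ V]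

/-- The coroot `α^∨ = 2α/⟨α,α⟩` of a vector `α`. -/
def coroot (α : V) : V := (2 / ⟪α, α⟫) • α

lemma refl_involutive (α : V) (k : ℝ) :
    Function.Involutive (fun x : V => x - (⟪x, coroot α⟫ + k) • α) := by
  intro x
  by_cases h : α = 0
  · simp [h, coroot]
  · have hαα : ⟪α, α⟫ ≠ 0 := fun hc => h (inner_self_eq_zero.mp hc)
    have h2 : ⟪α, coroot α⟫ = 2 := by
      rw [coroot, real_inner_smul_right]
      field_simp
    show (x - (⟪x, coroot α⟫ + k) • α) -
        (⟪x - (⟪x, coroot α⟫ + k) • α, coroot α⟫ + k) • α = x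
    rw [inner_sub_left, real_inner_smul_left, h2]
    have key : (⟪x, coroot α⟫ + k) +
        (⟪x, coroot α⟫ - (⟪x, coroot α⟫ + k) * 2 + k) = 0 := by ring
    rw [sub_sub, ← add_smul, key, zero_smul, sub_zero]

/-- The (affine) orthogonal reflection `x ↦ x - (⟨x,α^∨⟩ + k)α` as a permutation of `V`. -/
def reflP (α : V) (k : ℝ) : Equiv.Perm V :=
  Function.Involutive.toPerm _ (refl_involutive α k)

@[simp] lemma reflP_apply (α : V) (k : ℝ) (x : V) :
    reflP α k x = x - (⟪x, coroot α⟫ + k) • α := rfl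

/-- The sign of a real number, as an integer. -/
def zsgn (v : ℝ) : ℤ := if 0 < v then 1 else if v < 0 then -1 else 0

/-- Alternating composition `f ∘ g ∘ f ∘ ⋯` with `m` factors, used for braid relations. -/
def altOp {A : Type*} (f g : A → A) : ℕ → A → A
  | 0 => id
  | (k + 1) => f ∘ altOp g f k

/-- The interaction potential `v_α` entering the Morse (fusion) potential, for a
parameter family `s`. -/
def vintOf (s : V → ℝ) (α : V) (x : ℝ) : ℝ :=
  (1 - s α ^ 2) * ∫ y in (0:ℝ)..x, 1 / (1 - 2 * s α * Real.cos y + s α ^ 2)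

/-- All the standing data of the paper: an irreducible reduced crystallographic root
system `R₀` spanning the Euclidean space `V`, with a positive system, simple roots,
highest (short) roots, an admissible pair `(R₀, R̂₀)` encoded by the map `hat` and the
affine root `α₀`, a `W₀`-invariant multiplicity function `t` with values in `(-1,1)`,
and an integral level `c > 1`. -/
structure Setup (V : Type*) [NormedAddCommGroup V] [InnerProductSpace ℝ V]
    [FiniteDimensional ℝ V] where
  n : ℕ
  npos : 0 < n
  hdim : Module.finrank ℝ V = n
  R0 : Finset V
  zero_not_mem : (0 : V) ∉ R0
  span_top : Submodule.span ℝ (R0 : Set V) = ⊤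
  cryst : ∀ α ∈ R0, ∀ β ∈ R0, ∃ k : ℤ, ⟪β, coroot α⟫ = (k : ℝ)
  refl_mem : ∀ α ∈ R0, ∀ β ∈ R0, β - ⟪β, coroot α⟫ • α ∈ R0
  reduced : ∀ α ∈ R0, ∀ r : ℝ, r • α ∈ R0 → r = 1 ∨ r = -1
  irred : ¬ ∃ A B : Set V, A.Nonempty ∧ B.Nonempty ∧ A ∪ B = (R0 : Set V) ∧
      ∀ α ∈ A, ∀ β ∈ B, ⟪α, β⟫ = 0
  Rpos : Finset V
  pos_subset : Rpos ⊆ R0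
  pos_partition : ∀ α ∈ R0, (α ∈ Rpos ↔ -α ∉ Rpos)
  simple : Fin n → V
  simple_mem : ∀ j, simple j ∈ Rpos
  pos_decomp : ∀ α ∈ Rpos, ∃ f : Fin n → ℕ, α = ∑ j, (f j : ℝ) • simple j
  hroot : V
  hroot_mem : hroot ∈ Rpos
  hroot_highest : ∀ β ∈ R0, ∃ f : Fin n → ℕ, hroot - β = ∑ j, (f j : ℝ) • simple j
  hs : V
  hs_mem : hs ∈ Rpos
  hs_short : ∀ α ∈ R0, ⟪hs, hs⟫ ≤ ⟪α, α⟫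
  hs_highest : ∀ β ∈ R0, ⟪β, β⟫ = ⟪hs, hs⟫ →
      ∃ f : Fin n → ℕ, hs - β = ∑ j, (f j : ℝ) • simple j
  hat : V → V
  a0 : V
  admissible : ((∀ α : V, hat α = coroot α) ∧ a0 = -hs) ∨
      ((∀ α : V, hat α = (2 / ⟪hroot, hroot⟫) • α) ∧ a0 = -hroot)
  t : V → ℝ
  t_bound : ∀ α ∈ R0, |t α| < 1
  t_invariant : ∀ α ∈ R0, ∀ β ∈ R0, t (β - ⟪β, coroot α⟫ • α) = t β
  c : ℤ
  c_gt : 1 < c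

namespace Setup

variable (S : Setup V)

/-- `m_α = 2/⟨α, α̂⟩`. -/
def m (α : V) : ℝ := 2 / ⟪α, S.hat α⟫

/-- The finite Weyl group `W₀`, generated by the reflections in the roots. -/
def W0 : Subgroup (Equiv.Perm V) :=
  Subgroup.closure {w | ∃ α ∈ S.R0, w = reflP α 0}

/-- The affine Weyl group `W`, generated by the affine reflections
`s_a` for `a = α^∨ + m_α r c`. -/
def W : Subgroup (Equiv.Perm V) :=
  Subgroup.closure {w | ∃ α ∈ S.R0, ∃ r : ℤ, w = reflP α (S.m α * (r : ℝ) * (S.c : ℝ))}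

/-- The `W₀`-orbit of a vector. -/
def orb (ω : V) : Set V := {x | ∃ w ∈ S.W0, w ω = x}

/-- The weight lattice `P` of `R₀`. -/
def Plat : Set V := {x | ∀ α ∈ S.R0, ∃ k : ℤ, ⟪x, coroot α⟫ = (k : ℝ)}

/-- The root lattice `Q` of `R₀`. -/
def Qlat : Set V := (AddSubgroup.closure (S.R0 : Set V) : Set V)

/-- The semigroup `Q⁺` generated by the positive roots. -/
def Qplus : Set V := (AddSubmonoid.closure (S.Rpos : Set V) : Set V)

/-- The cone `P⁺` of dominant weights. -/
def Pplus : Set V := {x | x ∈ S.Plat ∧ ∀ α ∈ S.Rpos, 0 ≤ ⟪x, coroot α⟫}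

/-- The dominant affine alcove `A_c = {x | 0 ≤ ⟨x,β⟩ ≤ c ∀ β ∈ R̂₀⁺}`. -/
def Alc : Set V := {x | ∀ α ∈ S.Rpos, 0 ≤ ⟪x, S.hat α⟫ ∧ ⟪x, S.hat α⟫ ≤ (S.c : ℝ)}

/-- `P_c = P ∩ A_c`. -/
def Pc : Set V := {x | x ∈ S.Plat ∧ x ∈ S.Alc}

/-- The weight lattice `P̂` of `R̂₀`. -/
def Phat : Set V := {x | ∀ α ∈ S.R0, ∃ k : ℤ, ⟪x, coroot (S.hat α)⟫ = (k : ℝ)}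

/-- `P̂_c = {μ ∈ P̂ | 0 ≤ ⟨μ,α⟩ ≤ c ∀ α ∈ R₀⁺}`. -/
def Phatc : Set V :=
  {x | x ∈ S.Phat ∧ ∀ α ∈ S.Rpos, 0 ≤ ⟪x, α⟫ ∧ ⟪x, α⟫ ≤ (S.c : ℝ)}

/-- The half sum `ρ` of the positive roots of `R₀`. -/
def rho : V := (2⁻¹ : ℝ) • ∑ α ∈ S.Rpos, α

/-- The half sum `ρ̂` of the positive roots of `R̂₀`. -/
def rhoHat : V := (2⁻¹ : ℝ) • ∑ α ∈ S.Rpos, S.hat α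

/-- The coroot lattice `Q̂^∨` of `R̂₀`. -/
def Qhatvee : Set V :=
  (AddSubgroup.closure ((fun α => coroot (S.hat α)) '' (S.R0 : Set V)) : Set V)

/-- The gradient (direction) of the affine simple root `a_j`:
`α₀` for `j = 0` and `α_j` otherwise. -/
def alpha (j : Fin (S.n + 1)) : V :=
  if h : (j : ℕ) = 0 then S.a0 else S.simple ⟨(j : ℕ) - 1, by have := j.isLt; omega⟩

/-- The constant term of the affine simple root `a_j`. -/
def kconst (j : Fin (S.n + 1)) : ℝ := if (j : ℕ) = 0 then (S.c : ℝ) else 0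

/-- The affine simple root `a_j` as an affine function on `V`. -/
def aFun (j : Fin (S.n + 1)) (x : V) : ℝ := ⟪x, coroot (S.alpha j)⟫ + S.kconst j

/-- The simple affine reflections `s_0, s_1, …, s_n`. -/
def sgen (j : Fin (S.n + 1)) : Equiv.Perm V := reflP (S.alpha j) (S.kconst j)

/-- The length of an element of the affine Weyl group: the minimal length of an
expression as a product of the simple reflections. -/
def len (w : Equiv.Perm V) : ℕ :=
  sInf {k | ∃ l : List (Fin (S.n + 1)), l.length = k ∧ (l.map S.sgen).prod = w}

/-- The length of an element of the finite Weyl group w.r.t. the simple reflections. -/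
def len0 (w : Equiv.Perm V) : ℕ :=
  sInf {k | ∃ l : List (Fin S.n), l.length = k ∧
    (l.map fun j => reflP (S.simple j) 0).prod = w}

/-- `l` is a reduced expression for `w`. -/
def IsReducedWord (l : List (Fin (S.n + 1))) (w : Equiv.Perm V) : Prop :=
  (l.map S.sgen).prod = w ∧ l.length = S.len w

/-- The Bruhat partial order on the affine Weyl group. -/
def BruhatLE (v w : Equiv.Perm V) : Prop :=
  ∃ l : List (Fin (S.n + 1)), S.IsReducedWord l w ∧
    ∃ l' : List (Fin (S.n + 1)), l'.Sublist l ∧ (l'.map S.sgen).prod = v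

/-- Evaluation of a function on the weight lattice at a point of `V` (by `0` off `P`). -/
def ev (f : ↥S.Plat → ℂ) (x : V) : ℂ := if h : x ∈ S.Plat then f ⟨x, h⟩ else 0

/-- The integral part `J_j` of the integral-reflection operators. -/
def Jop (j : Fin (S.n + 1)) (f : ↥S.Plat → ℂ) (x : ↥S.Plat) : ℂ :=
  if 0 < Int.floor (S.aFun j x.1) then
    -∑ k ∈ Finset.Icc (1 : ℤ) (Int.floor (S.aFun j x.1)),
      S.ev f (x.1 - (k : ℝ) • S.alpha j)
  else if Int.floor (S.aFun j x.1) < 0 then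
    ∑ k ∈ Finset.Icc (0 : ℤ) (-(Int.floor (S.aFun j x.1)) - 1),
      S.ev f (x.1 + (k : ℝ) • S.alpha j)
  else 0

/-- The integral-reflection operators `T_j = t_j s_j + (t_j - 1) J_j` on `𝒞(P)`. -/
def Top (j : Fin (S.n + 1)) (f : ↥S.Plat → ℂ) (x : ↥S.Plat) : ℂ :=
  (S.t (S.alpha j) : ℂ) * S.ev f ((S.sgen j)⁻¹ x.1) +
    ((S.t (S.alpha j) : ℂ) - 1) * S.Jop j f x

/-- The operator `T_{j₁} ∘ ⋯ ∘ T_{j_ℓ}` attached to a word `l = [j₁, …, j_ℓ]`. -/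
def wordOp (l : List (Fin (S.n + 1))) : (↥S.Plat → ℂ) → (↥S.Plat → ℂ) :=
  l.foldr (fun j g => S.Top j ∘ g) id

/-- `TW` realizes `w ↦ T_w` (via reduced expressions). -/
def IsTW (TW : Equiv.Perm V → (↥S.Plat → ℂ) → (↥S.Plat → ℂ)) : Prop :=
  ∀ w l, S.IsReducedWord l w → TW w = S.wordOp l

/-- `tw` realizes the length multiplicative function `w ↦ t_w` (via reduced expressions). -/
def IsTmult (tw : Equiv.Perm V → ℂ) : Prop :=
  ∀ w l, S.IsReducedWord l w → tw w = (l.map fun j => (S.t (S.alpha j) : ℂ)).prod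

/-- `wmin` realizes `x ↦ w_x`, the unique shortest affine Weyl group element moving `x`
into the dominant alcove. -/
def IsShortest (wmin : V → Equiv.Perm V) : Prop :=
  ∀ x : V, wmin x ∈ S.W ∧ wmin x x ∈ S.Alc ∧
    ∀ w ∈ S.W, w x ∈ S.Alc →
      S.len (wmin x) ≤ S.len w ∧ (S.len w = S.len (wmin x) → w = wmin x)

/-- The positive affine roots, encoded as pairs `(α, r)` representing `α^∨ + m_α r c`. -/
def RplusP : Set (V × ℤ) :=
  {p | p.1 ∈ S.R0 ∧ (1 ≤ p.2 ∨ (p.2 = 0 ∧ p.1 ∈ S.Rpos))}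

/-- The value of the affine root encoded by `p = (α, r)` at a point of `V`. -/
def affval (p : V × ℤ) (x : V) : ℝ :=
  ⟪x, coroot p.1⟫ + S.m p.1 * (p.2 : ℝ) * (S.c : ℝ)

/-- `R[λ] = {a ∈ R⁺ | a(λ) < 0}`. -/
def Raff (lam : V) : Set (V × ℤ) := {p | p ∈ S.RplusP ∧ S.affval p lam < 0}

/-- `t[λ] = ∏_{a ∈ R[λ]} t_{a'}`. -/
def tBr (lam : V) : ℂ := ∏ᶠ p ∈ S.Raff lam, (S.t p.1 : ℂ)

/-- `θ(λ) = |{a ∈ R⁺ | a(λ) = -2}|`. -/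
def thetaCt (lam : V) : ℕ :=
  Set.ncard {p : V × ℤ | p ∈ S.RplusP ∧ S.affval p lam = -2}

/-- The affine intertwining operator `𝒥`, defined via `wmin` and `TW`. -/
def JJ (wmin : V → Equiv.Perm V) (TW : Equiv.Perm V → (↥S.Plat → ℂ) → (↥S.Plat → ℂ))
    (f : ↥S.Plat → ℂ) (x : ↥S.Plat) : ℂ :=
  (S.tBr x.1)⁻¹ * S.ev (TW (wmin x.1) f) (wmin x.1 x.1)

/-- The Morse (fusion-potential) function `𝒱_μ` for a parameter family `s`. -/
def MorseOf (s : V → ℝ) (μ ξ : V) : ℝ :=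
  ((S.c : ℝ) / 2) * ⟪ξ, ξ⟫ - 2 * Real.pi * ⟪S.rhoHat + μ, ξ⟫ +
    ∑ α ∈ S.Rpos, (2 / ⟪α, coroot (S.hat α)⟫) * ∫ x in (0:ℝ)..(⟪ξ, α⟫), vintOf s α x

/-- The Morse function `𝒱_μ` for the multiplicity function of the setup. -/
def Morse (μ ξ : V) : ℝ := S.MorseOf S.t μ ξ

/-- The critical equation `cξ + ∑_{α∈R₀⁺} v_α(⟨ξ,α⟩) α̂ = 2π(ρ̂ + μ)`. -/
def CritEq (μ x : V) : Prop :=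
  (S.c : ℝ) • x + ∑ α ∈ S.Rpos, (vintOf S.t α ⟪x, α⟫) • S.hat α =
    (2 * Real.pi) • (S.rhoHat + μ)

/-- Extension of a parameter vector indexed by `R₀` to a function on `V` (by zero). -/
def extParam (s : ↥S.R0 → ℝ) : V → ℝ := fun α => if h : α ∈ S.R0 then s ⟨α, h⟩ else 0

/-- `xi` realizes `μ ↦ ξ_μ`, the unique global minimizer of `𝒱_μ`. -/
def IsMinimizer (xi : V → V) : Prop :=
  ∀ μ ∈ S.Phat, ∀ x : V, x ≠ xi μ → S.Morse μ (xi μ) < S.Morse μ x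

/-- The `c`-function of the Macdonald spherical function. -/
def Cfun (ξ : V) : ℂ :=
  ∏ α ∈ S.Rpos, (1 - (S.t α : ℂ) * Complex.exp (-(Complex.I * (⟪ξ, α⟫ : ℂ)))) /
      (1 - Complex.exp (-(Complex.I * (⟪ξ, α⟫ : ℂ))))

/-- The Macdonald spherical function `M_λ(ξ)`. -/
def Msph (lam ξ : V) : ℂ :=
  ∑ᶠ w ∈ (S.W0 : Set (Equiv.Perm V)),
    S.Cfun (w ξ) * Complex.exp (Complex.I * (⟪w ξ, lam⟫ : ℂ))

/-- The orbit sum `m_ω(e^{iξ})`. -/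
def mSym (ω ξ : V) : ℂ := ∑ᶠ ν ∈ S.orb ω, Complex.exp (Complex.I * (⟪ν, ξ⟫ : ℂ))

/-- The plane wave `e^{iξ} ∈ 𝒞(P)`. -/
def planewave (ξ : V) : ↥S.Plat → ℂ :=
  fun lam => Complex.exp (Complex.I * (⟪lam.1, ξ⟫ : ℂ))

/-- The free operator `L_{ω;1}`. -/
def Lfree (ω : V) (f : ↥S.Plat → ℂ) (x : ↥S.Plat) : ℂ :=
  ∑ᶠ ν ∈ S.orb ω, S.ev f (x.1 + ν)

/-- `φ_ξ = ∑_{v ∈ W₀} T_v e^{iξ}`. -/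
def phiW (TW : Equiv.Perm V → (↥S.Plat → ℂ) → (↥S.Plat → ℂ)) (ξ : V) : ↥S.Plat → ℂ :=
  ∑ᶠ w ∈ (S.W0 : Set (Equiv.Perm V)), TW w (S.planewave ξ)

/-- The affine Macdonald spherical function `Φ_ξ = 𝒥 φ_ξ`. -/
def PhiA (wmin : V → Equiv.Perm V)
    (TW : Equiv.Perm V → (↥S.Plat → ℂ) → (↥S.Plat → ℂ)) (ξ : V) : ↥S.Plat → ℂ :=
  S.JJ wmin TW (S.phiW TW ξ)

/-- Invariance of a lattice function under the affine Weyl group. -/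
def Winv (f : ↥S.Plat → ℂ) : Prop :=
  ∀ w ∈ S.W, ∀ x : ↥S.Plat, S.ev f (w⁻¹ x.1) = f x

/-- A minuscule dominant weight. -/
def Minuscule (ω : V) : Prop := ω ∈ S.Pplus ∧ ∀ α ∈ S.Rpos, ⟪ω, coroot α⟫ ≤ 1

/-- `P_ϑ^⋆`: the orbit of the minuscule and quasi-minuscule weights. -/
def Pstar : Set V :=
  {x | ∃ w ∈ S.W0, ∃ η : V, (S.Minuscule η ∨ η = S.hs) ∧ x = w η}

/-- `ê_t(η) = ∏_{β∈R̂₀⁺} t_β^{⟨η,β^∨⟩/2}`. -/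
def et (η : V) : ℂ :=
  ∏ α ∈ S.Rpos, (S.t α : ℂ) ^ (((⟪η, coroot (S.hat α)⟫ / 2 : ℝ) : ℂ))

/-- `ĥ_t = t_{α₀} ê_t(-α₀^∨)`. -/
def hhat : ℂ := (S.t S.a0 : ℂ) * S.et (-(coroot S.a0))

/-- `e_t(ν) = ∏_{α∈R₀⁺} t_α^{⟨ν,α^∨⟩/2}`. -/
def elit (ν : V) : ℂ :=
  ∏ α ∈ S.Rpos, (S.t α : ℂ) ^ (((⟪ν, coroot α⟫ / 2 : ℝ) : ℂ))

/-- `h_t = t_ϑ e_t(-α₀)`. -/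
def hlit : ℂ := (S.t S.hs : ℂ) * S.elit (-S.a0)

/-- The coefficients `d_{λ,ν}`. -/
def dcoef (lam ν : V) : ℂ :=
  if ν ∈ S.orb S.hs then
    (S.thetaCt (lam + ν) : ℂ) * S.elit (-ν) * S.hlit ^ zsgn ⟪lam, S.hat ν⟫
  else 0

/-- The Pieri coefficients `V_{λ,ν}(t)`. -/
def Vcoef (lam ν : V) : ℂ :=
  (∏ α ∈ S.Rpos, if ⟪lam, S.hat α⟫ = 0 ∧ 0 < ⟪ν, S.hat α⟫ then
      (1 - (S.t α : ℂ) * S.et (S.hat α)) / (1 - S.et (S.hat α)) else 1) *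
  ∏ α ∈ S.Rpos, if ⟪lam, S.hat α⟫ = (S.c : ℝ) ∧ ⟪ν, S.hat α⟫ < 0 then
      (1 - (S.t α : ℂ) * S.hhat * S.et (-(S.hat α))) / (1 - S.hhat * S.et (-(S.hat α)))
    else 1

/-- The Pieri coefficients `U_{λ,ω}(t)`. -/
def Ucoef (wmin : V → Equiv.Perm V) (lam ω : V) : ℂ :=
  (∑ᶠ ν ∈ {ν | ν ∈ S.orb ω ∧ wmin (lam + ν) (lam + ν) = lam}, S.tBr (lam + ν)) +
    (1 - (S.t S.hs : ℂ)⁻¹) *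
      ∑ᶠ ν ∈ {ν | ν ∈ S.orb ω ∧ wmin (lam + ν) lam = lam}, S.dcoef lam ν

/-- The linear part of an affine transformation of `V`. -/
def linp (w : Equiv.Perm V) (x : V) : V := w x - w (0 : V)

/-- The set `[x] = {y | y₊ = x₊, w_y ≤ w_x}`. -/
def bra (wmin : V → Equiv.Perm V) (x : V) : Set V :=
  {y | wmin y y = wmin x x ∧ S.BruhatLE (wmin y) (wmin x)}

/-- The partial order `μ ⪯ λ`. -/
def preceq (wmin : V → Equiv.Perm V) (μ lam : V) : Prop :=
  lam - μ ∈ S.Qlat ∧ convexHull ℝ (S.bra wmin μ) ⊆ convexHull ℝ (S.bra wmin lam)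

/-- The Weyl denominator `δ(ξ)`. -/
def weylDenom (ξ : V) : ℂ :=
  ∏ α ∈ S.Rpos, (Complex.exp (Complex.I * (⟪ξ, α⟫ : ℂ) / 2) -
      Complex.exp (-(Complex.I * (⟪ξ, α⟫ : ℂ) / 2)))

/-- The Weyl character `χ_λ(ξ)`. -/
def chiW (lam ξ : V) : ℂ :=
  (S.weylDenom ξ)⁻¹ * ∑ᶠ w ∈ (S.W0 : Set (Equiv.Perm V)),
    ((-1 : ℂ) ^ S.len0 w) * Complex.exp (Complex.I * (⟪w ξ, lam + S.rho⟫ : ℂ))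

/-- The counting function `N_{λ,ω}`. -/
def Ncount (lam ω : V) : ℕ :=
  Nat.card {j : Fin (S.n + 1) // S.aFun j lam = 0 ∧ S.alpha j ∈ S.orb ω}

end Setup



set_option linter.unusedSectionVars false

/-- Abstract geometric data of an affine reflection group. -/
structure Geo (V : Type*) (ι : Type*) [NormedAddCommGroup V] [InnerProductSpace ℝ V] where
  s : ι → Equiv.Perm V
  b : ι → V → ℝ
  Pos : Set ((V → ℝ) × Equiv.Perm V)
  o : V
  b_mem : ∀ j, (b j, s j) ∈ Pos
  perm : ∀ f g j, (f, g) ∈ Pos → (f ∘ s j, s j * g * s j) ∈ Pos ∨ (f = b j ∧ g = s j)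
  pos_o : ∀ f g, (f, g) ∈ Pos → 0 < f o
  nonneg : ∀ f g x, (f, g) ∈ Pos → (∀ j, 0 ≤ b j x) → 0 ≤ f x
  fin : ∀ x, {f : V → ℝ | ∃ g, (f, g) ∈ Pos ∧ f x < 0}.Finite
  refl : ∀ f g, (f, g) ∈ Pos → ∃ v : V, ∃ k : ℝ, v ≠ 0 ∧ (∀ x, f x = ⟪x, v⟫ + k) ∧
    (∀ x, g x = x - f x • coroot v)

lemma inner_coroot_self {v : V} (hv : v ≠ 0) : ⟪coroot v, v⟫ = 2 := by
  have : ⟪v, v⟫ ≠ 0 := fun hc => hv (inner_self_eq_zero.mp hc)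
  rw [coroot, real_inner_smul_left]; field_simp

namespace Geo

variable {ι : Type*} (G : Geo V ι)

lemma f_g {f : V → ℝ} {g : Equiv.Perm V} (h : (f, g) ∈ G.Pos) (x : V) : f (g x) = - f x := by
  obtain ⟨v, k, hv, hf, hg⟩ := G.refl f g h
  rw [hf (g x), hg, inner_sub_left, real_inner_smul_left, inner_coroot_self hv, hf x]; ring

lemma g_g {f : V → ℝ} {g : Equiv.Perm V} (h : (f, g) ∈ G.Pos) (x : V) : g (g x) = x := by
  have h1 := G.f_g h x
  obtain ⟨v, k, hv, hf, hg⟩ := G.refl f g h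
  rw [hg (g x), h1, hg x]; simp

lemma g_eq {f : V → ℝ} {g : Equiv.Perm V} (h : (f, g) ∈ G.Pos) (x : V) (h0 : f x = 0) :
    g x = x := by
  obtain ⟨v, k, hv, hf, hg⟩ := G.refl f g h
  rw [hg, h0]; simp

lemma g_aff {f : V → ℝ} {g : Equiv.Perm V} (h : (f, g) ∈ G.Pos) (x y : V) (a b : ℝ)
    (hab : a + b = 1) : g (a • x + b • y) = a • g x + b • g y := by
  obtain ⟨v, k, hv, hf, hg⟩ := G.refl f g h
  have : f (a • x + b • y) = a * f x + b * f y := by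
    rw [hf, hf, hf, inner_add_left, real_inner_smul_left, real_inner_smul_left]
    linear_combination (-k) * hab
  rw [hg, hg, hg, this]
  module

lemma g_dist {f : V → ℝ} {g : Equiv.Perm V} (h : (f, g) ∈ G.Pos) (x : V) (hx : f x < 0) :
    dist (g x) G.o < dist x G.o := by
  have ho := G.pos_o f g h
  obtain ⟨v, k, hv, hf, hg⟩ := G.refl f g h
  rw [dist_eq_norm, dist_eq_norm]
  apply lt_of_pow_lt_pow_left₀ 2 (norm_nonneg _)
  have hvv : 0 < ⟪v, v⟫ := by
    rw [real_inner_self_eq_norm_sq]; positivity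
  rw [← real_inner_self_eq_norm_sq, ← real_inner_self_eq_norm_sq, hg]
  have e1 : x - f x • coroot v - G.o = (x - G.o) - f x • coroot v := by abel
  have e2 : ⟪x - G.o, coroot v⟫ = 2 / ⟪v, v⟫ * (f x - f G.o) := by
    rw [coroot, real_inner_smul_right, inner_sub_left, hf, hf]; ring
  have e3 : ⟪coroot v, coroot v⟫ = 2 / ⟪v, v⟫ * 2 := by
    have : ⟪coroot v, coroot v⟫ = 2 / ⟪v, v⟫ * ⟪coroot v, v⟫ := by
      conv_lhs => rhs; rw [coroot]
      rw [real_inner_smul_right]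
    rw [this, inner_coroot_self hv]
  generalize x - G.o = u at e1 e2 ⊢
  rw [e1, inner_sub_left, inner_sub_right, inner_sub_right, real_inner_smul_right,
    real_inner_smul_left, real_inner_smul_left, real_inner_smul_right,
    real_inner_comm u (coroot v), e2, e3]
  have : 0 < 2 / ⟪v, v⟫ := by positivity
  have h2 : 0 < 2 / ⟪v, v⟫ * ((-f x) * f G.o) := mul_pos this (mul_pos (by linarith) ho)
  nlinarith

lemma s_s (j : ι) (x : V) : G.s j (G.s j x) = x := G.g_g (G.b_mem j) x

lemma s_inv (j : ι) : (G.s j)⁻¹ = G.s j := by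
  ext x; rw [Equiv.Perm.inv_eq_iff_eq, G.s_s]

lemma b_s (j : ι) (x : V) : G.b j (G.s j x) = - G.b j x := G.f_g (G.b_mem j) x

/-- The alcove. -/
def Alc : Set V := {x | ∀ j, 0 ≤ G.b j x}

/-- End point of a word path. -/
def pt (l : List ι) (x : V) : V := (l.map G.s).prod⁻¹ x

@[simp] lemma pt_nil (x : V) : G.pt [] x = x := by simp [pt]

@[simp] lemma pt_cons (j : ι) (l : List ι) (x : V) : G.pt (j :: l) x = G.pt l (G.s j x) := by
  simp [pt, mul_inv_rev, G.s_inv]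

lemma pt_append (l l' : List ι) (x : V) : G.pt (l ++ l') x = G.pt l' (G.pt l x) := by
  induction l generalizing x with
  | nil => simp
  | cons j l ih => simp [ih]

lemma pt_aff (l : List ι) (x y : V) (a b : ℝ) (hab : a + b = 1) :
    G.pt l (a • x + b • y) = a • G.pt l x + b • G.pt l y := by
  induction l generalizing x y with
  | nil => simp
  | cons j l ih => rw [pt_cons, G.g_aff (G.b_mem j) x y a b hab, ih]; simp

/-- Points reachable by subwords. -/
def D (l : List ι) (x : V) : Set V := {y | ∃ l', l'.Sublist l ∧ G.pt l' x = y}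

/-- Strictly positive paths. -/
def SP : List ι → V → Prop
  | [], _ => True
  | (j :: l), x => 0 < G.b j x ∧ SP l (G.s j x)

lemma SP_append (l l' : List ι) (x : V) :
    G.SP (l ++ l') x ↔ G.SP l x ∧ G.SP l' (G.pt l x) := by
  induction l generalizing x with
  | nil => simp [SP]
  | cons j l ih => simp [SP, ih, and_assoc]

lemma D_append (l : List ι) (j : ι) (x : V) :
    ∀ y ∈ G.D (l ++ [j]) x, y ∈ G.D l x ∨ G.s j y ∈ G.D l x := by
  rintro y ⟨l', hl', rfl⟩
  obtain ⟨l1, l2, rfl, h1, h2⟩ := List.sublist_append_iff.mp hl'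
  rcases List.sublist_cons_iff.mp h2 with h | ⟨r, rfl, hr⟩
  · rw [List.sublist_nil.mp h]; left; exact ⟨l1, h1, by simp⟩
  · rw [List.sublist_nil.mp hr]; right; exact ⟨l1, h1, by simp [pt_append, G.s_s]⟩

lemma D_cons_left (l : List ι) (j : ι) (x : V) : G.D l x ⊆ G.D (j :: l) x := by
  rintro y ⟨l', hl', rfl⟩; exact ⟨l', hl'.cons j, rfl⟩

lemma D_cons_right (l : List ι) (j : ι) (x : V) : G.D l (G.s j x) ⊆ G.D (j :: l) x := by
  rintro y ⟨l', hl', rfl⟩; exact ⟨j :: l', hl'.cons_cons j, by simp⟩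

lemma deletion (l : List ι) : ∀ (f : V → ℝ) (g : Equiv.Perm V) (x : V), (f, g) ∈ G.Pos →
    x ∈ G.Alc → f (G.pt l x) < 0 →
    (∃ l', l'.Sublist l ∧ l'.length < l.length ∧ G.pt l' x = g (G.pt l x)) ∧
    ∃ l0 : List ι, g = (l0.map G.s).prod := by
  induction l using List.reverseRecOn with
  | nil =>
    intro f g x h hx hf
    exact absurd (G.nonneg f g x h hx) (by simpa using hf)
  | append_singleton l j ih =>
    intro f g x h hx hf
    rw [pt_append] at hf ⊢
    rcases G.perm f g j h with h' | ⟨rfl, rfl⟩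
    · obtain ⟨⟨l', h1, h2, h3⟩, l0, h4⟩ := ih _ _ x h' hx (by simpa using hf)
      refine ⟨⟨l' ++ [j], h1.append_right _, by simpa using h2, ?_⟩, j :: (l0 ++ [j]), ?_⟩
      · rw [pt_append, h3]; simp [G.s_s]
      · have : G.s j * G.s j = 1 := by ext x; simp [G.s_s]
        simp only [List.map_cons, List.map_append, List.prod_cons, List.prod_append, ← h4]
        simp only [List.map_nil, List.prod_nil, mul_one]
        calc g = (G.s j * G.s j) * g * (G.s j * G.s j) := by rw [this]; simp
          _ = _ := by group
    · exact ⟨⟨l, by simp, by simp, by simp [G.s_s]⟩, [j], by simp⟩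

lemma exists_SP (k : ℕ) : ∀ (l : List ι) (x : V), l.length ≤ k → x ∈ G.Alc →
    ∃ l', l'.Sublist l ∧ G.SP l' x ∧ G.pt l' x = G.pt l x := by
  induction k with
  | zero =>
    intro l x hl hx
    have : l = [] := by simpa using hl
    subst this
    exact ⟨[], by simp, by simp [SP], rfl⟩
  | succ k ih =>
    intro l x hl hx
    rcases List.eq_nil_or_concat l with rfl | ⟨l1, j, rfl⟩
    · exact ⟨[], by simp, by simp [SP], rfl⟩
    have hl1 : l1.length ≤ k := by simpa using hl
    obtain ⟨l', h1, h2, h3⟩ := ih l1 x hl1 hx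
    rw [List.concat_eq_append, pt_append]
    rcases lt_trichotomy (G.b j (G.pt l1 x)) 0 with hlt | heq | hgt
    · obtain ⟨⟨l2, h4, h5, h6⟩, -⟩ := G.deletion l1 _ _ x (G.b_mem j) hx hlt
      obtain ⟨l3, h7, h8, h9⟩ := ih l2 x (by omega) hx
      exact ⟨l3, (h7.trans h4).trans (by simp), h8, by rw [h9, h6]; simp⟩
    · refine ⟨l', h1.trans (by simp), h2, ?_⟩
      rw [h3]; simp [G.g_eq (G.b_mem j) _ heq]
    · refine ⟨l' ++ [j], h1.append_right _, ?_, by simp [pt_append, h3]⟩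
      rw [SP_append, h3]; exact ⟨h2, hgt, trivial⟩

/-- Negative roots at a point. -/
def neg (x : V) : Set (V → ℝ) := {f : V → ℝ | ∃ g, (f, g) ∈ G.Pos ∧ f x < 0}

/-- Number of separating hyperplanes. -/
def N (x : V) : ℕ := (G.neg x).ncard

lemma N_le (j : ι) (x : V) : G.N (G.s j x) ≤ G.N x + 1 := by
  have hsub : G.neg (G.s j x) ⊆ insert (G.b j) ((fun f : V → ℝ => f ∘ G.s j) '' G.neg x) := by
    rintro f ⟨g, h, hf⟩
    rcases G.perm f g j h with h' | ⟨rfl, rfl⟩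
    · right
      refine ⟨f ∘ G.s j, ⟨_, h', hf⟩, ?_⟩
      ext y; simp [G.s_s]
    · left; rfl
  have hfin : ((fun f : V → ℝ => f ∘ G.s j) '' G.neg x).Finite := (G.fin x).image _
  calc G.N (G.s j x) ≤ _ := Set.ncard_le_ncard hsub (hfin.insert _)
    _ ≤ _ := Set.ncard_insert_le _ _
    _ ≤ _ := Nat.add_le_add_right (Set.ncard_image_le (G.fin x)) 1

lemma N_ge (j : ι) (x : V) (hj : 0 < G.b j x) : G.N x + 1 ≤ G.N (G.s j x) := by
  have hsub : insert (G.b j) ((fun f : V → ℝ => f ∘ G.s j) '' G.neg x) ⊆ G.neg (G.s j x) := by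
    rintro f (rfl | ⟨f, ⟨g, h, hf⟩, rfl⟩)
    · exact ⟨_, G.b_mem j, by rw [G.b_s]; linarith⟩
    · rcases G.perm f g j h with h' | ⟨rfl, rfl⟩
      · exact ⟨_, h', by simpa [G.s_s] using hf⟩
      · linarith
  have hfin : ((fun f : V → ℝ => f ∘ G.s j) '' G.neg x).Finite := (G.fin x).image _
  have hnot : G.b j ∉ ((fun f : V → ℝ => f ∘ G.s j) '' G.neg x) := by
    rintro ⟨f, ⟨g, h, hf⟩, he⟩
    have h1 := congrFun he (G.s j G.o)
    simp only [Function.comp_apply, G.s_s, G.b_s] at h1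
    have h2 := G.pos_o _ _ h
    have h3 := G.pos_o _ _ (G.b_mem j)
    linarith
  have hinj : Function.Injective (fun f : V → ℝ => f ∘ G.s j) := by
    intro f f' h
    ext y
    have := congrFun h (G.s j y)
    simpa [G.s_s] using this
  have := Set.ncard_le_ncard hsub (G.fin _)
  rw [Set.ncard_insert_of_notMem hnot hfin, Set.ncard_image_of_injective _ hinj] at this
  exact this

lemma N_alc {x : V} (hx : x ∈ G.Alc) : G.N x = 0 := by
  have : G.neg x = ∅ := by
    ext f; simp only [Set.mem_empty_iff_false, iff_false]
    rintro ⟨g, h, hf⟩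
    exact absurd (G.nonneg f g x h hx) (by linarith)
  rw [N, this, Set.ncard_empty]

lemma N_pt_le (l : List ι) (x : V) : G.N (G.pt l x) ≤ G.N x + l.length := by
  induction l generalizing x with
  | nil => simp
  | cons j l ih =>
    have := ih (G.s j x); have := G.N_le j x
    simp only [pt_cons, List.length_cons]; omega

lemma N_pt_ge (l : List ι) (x : V) (h : G.SP l x) : G.N x + l.length ≤ G.N (G.pt l x) := by
  induction l generalizing x with
  | nil => simp
  | cons j l ih =>
    have := ih (G.s j x) h.2; have := G.N_ge j x h.1
    simp only [pt_cons, List.length_cons]; omega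

/-- Closed under raising reflections. -/
def RC (K : Set V) : Prop := ∀ f g z, (f, g) ∈ G.Pos → z ∈ K → f z < 0 → g z ∈ K

lemma D_subset_of_RC (l : List ι) : ∀ (K : Set V) (x : V), G.RC K → G.SP l x → G.pt l x ∈ K →
    G.D l x ⊆ K := by
  induction l using List.reverseRecOn with
  | nil =>
    rintro K x - - h y ⟨l', hl', rfl⟩
    rw [List.sublist_nil.mp hl']; exact h
  | append_singleton l j ih =>
    intro K x hK hs h y hy
    rw [SP_append] at hs
    obtain ⟨hs1, hs2, -⟩ := hs
    rw [pt_append, pt_cons, pt_nil] at h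
    have hRC : G.RC {z | z ∈ K ∧ G.s j z ∈ K} := by
      rintro f g z hfg ⟨hz1, hz2⟩ hf
      refine ⟨hK f g z hfg hz1 hf, ?_⟩
      rcases G.perm f g j hfg with h' | ⟨rfl, rfl⟩
      · have := hK _ _ _ h' hz2 (by simpa [G.s_s] using hf)
        simpa [G.s_s] using this
      · rw [G.s_s]; exact hz1
    have h0 : G.pt l x ∈ K := by
      have := hK _ _ _ (G.b_mem j) h (by rw [G.b_s]; linarith)
      rwa [G.s_s] at this
    have hD := ih _ x hRC hs1 ⟨h0, h⟩
    rcases G.D_append l j x y hy with h1 | h1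
    · exact (hD h1).1
    · have := (hD h1).2
      rwa [G.s_s] at this

lemma RC_ball (p : V) : G.RC {z | z = p ∨ dist z G.o < dist p G.o} := by
  rintro f g z h hz hf
  have := G.g_dist h z hf
  right
  rcases hz with rfl | hz
  · exact this
  · exact this.trans hz

lemma RC_convexHull {A : Set V} (hA : G.RC A) : G.RC (convexHull ℝ A) := by
  intro f g z h hz hf
  have hg := h
  obtain ⟨v, k, hv, hf', hg'⟩ := G.refl f g hg
  have key : convexHull ℝ A ⊆
      {η | ∃ τ : ℝ, 0 ≤ τ ∧ -f η ≤ τ ∧ η + τ • coroot v ∈ convexHull ℝ A} := by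
    apply convexHull_min
    · intro η hη
      by_cases hn : f η < 0
      · refine ⟨-f η, by linarith, le_rfl, ?_⟩
        have := subset_convexHull ℝ _ (hA f g η h hη hn)
        rw [hg'] at this
        rwa [neg_smul, ← sub_eq_add_neg]
      · exact ⟨0, le_rfl, by linarith, by simpa using subset_convexHull ℝ _ hη⟩
    · rintro η1 ⟨τ1, h1, h2, h3⟩ η2 ⟨τ2, h4, h5, h6⟩ a b ha hb hab
      refine ⟨a * τ1 + b * τ2, by positivity, ?_, ?_⟩
      · have : f (a • η1 + b • η2) = a * f η1 + b * f η2 := by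
          rw [hf', hf', hf', inner_add_left, real_inner_smul_left, real_inner_smul_left]
          linear_combination (-k) * hab
        rw [this]; nlinarith
      · have := convex_convexHull ℝ A h3 h6 ha hb hab
        convert this using 1
        module
  obtain ⟨τ, h1, h2, h3⟩ := key hz
  have hτ : 0 < τ := by linarith
  have := convex_convexHull ℝ A hz h3 (a := 1 - (-f z) / τ) (b := (-f z) / τ)
    (by rw [sub_nonneg, div_le_one hτ]; exact h2) (div_nonneg (by linarith) h1) (by ring)
  convert this using 1
  rw [hg', smul_add, smul_smul, div_mul_cancel₀ _ hτ.ne']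
  module

lemma RC_D (l : List ι) (x : V) (hx : x ∈ G.Alc) : G.RC (G.D l x) := by
  rintro f g z h ⟨l', hl', rfl⟩ hf
  obtain ⟨⟨l2, h1, -, h2⟩, -⟩ := G.deletion l' f g x h hx hf
  exact ⟨l2, h1.trans hl', h2⟩

lemma exists_word (k : ℕ) : ∀ z : V, G.N z ≤ k → ∃ l x, x ∈ G.Alc ∧ G.pt l x = z := by
  induction k with
  | zero =>
    intro z hz
    refine ⟨[], z, ?_, by simp⟩
    intro j
    by_contra hn
    have := G.N_ge j (G.s j z) (by rw [G.b_s]; linarith)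
    rw [G.s_s] at this; omega
  | succ k ih =>
    intro z hz
    by_cases hA : z ∈ G.Alc
    · exact ⟨[], z, hA, by simp⟩
    · simp only [Alc, Set.mem_ofPred_eq, not_forall, not_le] at hA
      obtain ⟨j, hj⟩ := hA
      have := G.N_ge j (G.s j z) (by rw [G.b_s]; linarith)
      rw [G.s_s] at this
      obtain ⟨l, x, hx, h⟩ := ih (G.s j z) (by omega)
      exact ⟨l ++ [j], x, hx, by simp [pt_append, h, G.s_s]⟩

lemma gen {f : V → ℝ} {g : Equiv.Perm V} (h : (f, g) ∈ G.Pos) :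
    ∃ l0 : List ι, g = (l0.map G.s).prod := by
  obtain ⟨l, x, hx, he⟩ := G.exists_word _ (g G.o) le_rfl
  have h1 := G.f_g h G.o
  have h2 := G.pos_o _ _ h
  exact (G.deletion l f g x h hx (by rw [he, h1]; linarith)).2

end Geo

namespace Setup

variable (S : Setup V)

lemma root_ne {α : V} (h : α ∈ S.R0) : α ≠ 0 := fun h0 => S.zero_not_mem (h0 ▸ h)

lemma inner_pos {α : V} (h : α ∈ S.R0) : 0 < ⟪α, α⟫ := by
  have := S.root_ne h
  rw [real_inner_self_eq_norm_sq]; positivity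

lemma inner_coroot (x α : V) : ⟪x, coroot α⟫ = 2 / ⟪α, α⟫ * ⟪x, α⟫ := by
  rw [coroot, real_inner_smul_right]

lemma neg_mem' {α : V} (h : α ∈ S.R0) : -α ∈ S.R0 := by
  have h1 := S.refl_mem α h α h
  have h2 : ⟪α, coroot α⟫ = 2 := by rw [real_inner_comm, inner_coroot_self (S.root_ne h)]
  rw [h2] at h1
  convert h1 using 1
  module

lemma pos_or {α : V} (h : α ∈ S.R0) : α ∈ S.Rpos ∨ -α ∈ S.Rpos := by
  by_cases h1 : -α ∈ S.Rpos
  · exact Or.inr h1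
  · exact Or.inl ((S.pos_partition α h).2 h1)

lemma refl_norm (α β : V) : ⟪β - ⟪β, coroot α⟫ • α, β - ⟪β, coroot α⟫ • α⟫ = ⟪β, β⟫ := by
  by_cases h : α = 0
  · simp [h]
  · have h1 : ⟪α, α⟫ ≠ 0 := fun hc => h (inner_self_eq_zero.mp hc)
    rw [inner_sub_left, inner_sub_right, inner_sub_right, real_inner_smul_right,
      real_inner_smul_left, real_inner_smul_left, real_inner_smul_right, inner_coroot,
      real_inner_comm β α]
    field_simp
    ring

lemma span_simple : ⊤ ≤ Submodule.span ℝ (Set.range S.simple) := by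
  rw [← S.span_top, Submodule.span_le]
  have key : ∀ α ∈ S.Rpos, α ∈ Submodule.span ℝ (Set.range S.simple) := by
    intro α hα
    obtain ⟨f, hf⟩ := S.pos_decomp α hα
    rw [hf]
    exact Submodule.sum_mem _ fun j _ => Submodule.smul_mem _ _ (Submodule.subset_span ⟨j, rfl⟩)
  intro α hα
  rcases S.pos_or hα with h | h
  · exact key _ h
  · have := Submodule.neg_mem _ (key _ h)
    rwa [neg_neg] at this

lemma linInd : LinearIndependent ℝ S.simple :=
  linearIndependent_of_top_le_span_of_card_eq_finrank S.span_simple (by simp [S.hdim])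

lemma exists_d : ∃ d : V, ∀ j, ⟪d, S.simple j⟫ = 1 := by
  let b := Module.Basis.mk S.linInd S.span_simple
  let φ : V →ₗ[ℝ] ℝ := b.constr ℝ (fun _ => (1 : ℝ))
  refine ⟨(InnerProductSpace.toDual ℝ V).symm (LinearMap.toContinuousLinearMap φ), fun j => ?_⟩
  rw [InnerProductSpace.toDual_symm_apply]
  have : S.simple j = b j := by simp [b]
  rw [this]
  simp [φ]

lemma inner_sum_nonneg {x : V} (hx : ∀ j, 0 ≤ ⟪x, S.simple j⟫) (f : Fin S.n → ℕ) :
    0 ≤ ⟪x, ∑ j, (f j : ℝ) • S.simple j⟫ := by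
  rw [inner_sum]
  exact Finset.sum_nonneg fun j _ => by
    rw [real_inner_smul_right]; exact mul_nonneg (Nat.cast_nonneg _) (hx j)

lemma dom {x : V} (hx : ∀ j, 0 ≤ ⟪x, S.simple j⟫) {α : V} (hα : α ∈ S.Rpos) : 0 ≤ ⟪x, α⟫ := by
  obtain ⟨f, hf⟩ := S.pos_decomp α hα
  rw [hf]; exact S.inner_sum_nonneg hx f

lemma pos_d {d : V} (hd : ∀ j, ⟪d, S.simple j⟫ = 1) {α : V} (hα : α ∈ S.Rpos) : 0 < ⟪d, α⟫ := by
  obtain ⟨f, hf⟩ := S.pos_decomp α hα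
  rw [hf, inner_sum]
  simp only [real_inner_smul_right, hd, mul_one]
  by_contra hn
  have h0 : ∑ j, (f j : ℝ) = 0 :=
    le_antisymm (not_lt.mp hn) (Finset.sum_nonneg fun j _ => Nat.cast_nonneg _)
  rw [Finset.sum_eq_zero_iff_of_nonneg (fun j _ => Nat.cast_nonneg _)] at h0
  apply S.root_ne (S.pos_subset hα)
  rw [hf]
  exact Finset.sum_eq_zero fun j hj => by rw [h0 j hj, zero_smul]

lemma dom_of_highest {θ : V}
    (hθ : ∀ β ∈ S.R0, ⟪β, β⟫ = ⟪θ, θ⟫ → ∃ f : Fin S.n → ℕ, θ - β = ∑ j, (f j : ℝ) • S.simple j)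
    (hθR : θ ∈ S.R0) {α : V} (hα : α ∈ S.Rpos) : 0 ≤ ⟪θ, α⟫ := by
  obtain ⟨d, hd⟩ := S.exists_d
  by_contra hn
  obtain ⟨f, hf⟩ := hθ _ (S.refl_mem α (S.pos_subset hα) θ hθR) (refl_norm α θ)
  have h1 := S.inner_sum_nonneg (x := d) (fun j => by rw [hd]; exact zero_le_one) f
  rw [← hf, sub_sub_cancel, real_inner_smul_right, inner_coroot] at h1
  have h2 := S.pos_d hd hα
  have h3 := S.inner_pos (S.pos_subset hα)
  have h4 : 0 < 2 / ⟪α, α⟫ * (-⟪θ, α⟫) := by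
    have : 0 < -⟪θ, α⟫ := by linarith
    positivity
  nlinarith

lemma hroot_long {α : V} (hα : α ∈ S.R0) : ⟪α, α⟫ ≤ ⟪S.hroot, S.hroot⟫ := by
  obtain ⟨d, hd⟩ := S.exists_d
  have hφ := S.pos_subset S.hroot_mem
  obtain ⟨β, hβ, hmax⟩ := Finset.exists_max_image (S.R0.filter fun β => ⟪β, β⟫ = ⟪α, α⟫)
    (fun β => ⟪d, β⟫) ⟨α, by simp [hα]⟩
  rw [Finset.mem_filter] at hβ
  have hdom : ∀ j, 0 ≤ ⟪β, S.simple j⟫ := by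
    intro j
    by_contra hn
    have hj := S.pos_subset (S.simple_mem j)
    have h1 := hmax (β - ⟪β, coroot (S.simple j)⟫ • S.simple j)
      (Finset.mem_filter.2 ⟨S.refl_mem _ hj _ hβ.1, by rw [refl_norm, hβ.2]⟩)
    simp only [inner_sub_right, real_inner_smul_right, hd, inner_coroot] at h1
    have h3 := S.inner_pos hj
    have h4 : 0 < 2 / ⟪S.simple j, S.simple j⟫ * (-⟪β, S.simple j⟫) := by
      have : 0 < -⟪β, S.simple j⟫ := by linarith
      positivity
    linarith
  obtain ⟨f, hf⟩ := S.hroot_highest β hβ.1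
  have h1 := S.inner_sum_nonneg hdom f
  have h2 := S.inner_sum_nonneg (x := S.hroot) (fun j => S.dom_of_highest
    (fun β hβ _ => S.hroot_highest β hβ) hφ (S.simple_mem j)) f
  rw [← hf, inner_sub_right] at h1 h2
  rw [real_inner_comm] at h1
  linarith [hβ.2]

/-- every root is non-orthogonal to some short root -/
lemma exists_short {α : V} (hα : α ∈ S.R0) :
    ∃ β ∈ S.R0, ⟪β, β⟫ = ⟪S.hs, S.hs⟫ ∧ ⟪α, β⟫ ≠ 0 := by
  by_contra hn
  push Not at hn
  have hhs := S.pos_subset S.hs_mem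
  refine S.irred ⟨{γ | γ ∈ S.R0 ∧ ∃ β ∈ S.R0, ⟪β, β⟫ = ⟪S.hs, S.hs⟫ ∧ ⟪γ, β⟫ ≠ 0},
    {γ | γ ∈ S.R0 ∧ ∀ β ∈ S.R0, ⟪β, β⟫ = ⟪S.hs, S.hs⟫ → ⟪γ, β⟫ = 0},
    ⟨S.hs, hhs, S.hs, hhs, rfl, (S.inner_pos hhs).ne'⟩, ⟨α, hα, hn⟩, ?_, ?_⟩
  · ext γ
    simp only [Set.mem_union, Set.mem_ofPred_eq, Finset.mem_coe]
    constructor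
    · rintro (h | h) <;> exact h.1
    · intro h
      by_cases h1 : ∃ β ∈ S.R0, ⟪β, β⟫ = ⟪S.hs, S.hs⟫ ∧ ⟪γ, β⟫ ≠ 0
      · exact Or.inl ⟨h, h1⟩
      · push Not at h1
        exact Or.inr ⟨h, h1⟩
  · rintro γ ⟨hγ, β, hβ, hβs, hne⟩ δ ⟨hδ, hδ0⟩
    have h1 := hδ0 _ (S.refl_mem γ hγ β hβ) (by rw [refl_norm, hβs])
    rw [inner_sub_right, hδ0 β hβ hβs, real_inner_smul_right, inner_coroot, zero_sub,
      neg_eq_zero] at h1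
    have h2 : 2 / ⟪γ, γ⟫ * ⟪β, γ⟫ ≠ 0 := by
      have := (S.inner_pos hγ).ne'
      rw [real_inner_comm γ β]
      positivity
    rw [real_inner_comm]
    exact (mul_eq_zero.mp h1).resolve_left h2

lemma hs_coroot_highest {x : V} (hx : ∀ j, 0 ≤ ⟪x, S.simple j⟫) {α : V} (hα : α ∈ S.R0) :
    ⟪x, coroot α⟫ ≤ ⟪x, coroot S.hs⟫ := by
  have hhs := S.pos_subset S.hs_mem
  have hs0 := S.inner_pos hhs
  have short : ∀ β ∈ S.R0, ⟪β, β⟫ = ⟪S.hs, S.hs⟫ → ⟪x, β⟫ ≤ ⟪x, S.hs⟫ := by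
    intro β hβ h
    obtain ⟨f, hf⟩ := S.hs_highest β hβ h
    have := S.inner_sum_nonneg hx f
    rw [← hf, inner_sub_right] at this
    linarith
  rw [inner_coroot, inner_coroot]
  obtain ⟨β0, hβ0, hβs0, hne⟩ := S.exists_short hα
  obtain ⟨β, hβ, hβs, hpos⟩ : ∃ β ∈ S.R0, ⟪β, β⟫ = ⟪S.hs, S.hs⟫ ∧ 0 < ⟪α, β⟫ := by
    rcases lt_or_gt_of_ne hne with h | h
    · exact ⟨-β0, S.neg_mem' hβ0, by simpa using hβs0, by simpa using h⟩
    · exact ⟨β0, hβ0, hβs0, h⟩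
  have hα0 := S.inner_pos hα
  rcases (S.hs_short α hα).eq_or_lt with he | hlt
  · rw [← he]
    exact mul_le_mul_of_nonneg_left (short α hα he.symm) (by positivity)
  · -- long case
    obtain ⟨k, hk⟩ := S.cryst α hα β hβ
    obtain ⟨k', hk'⟩ := S.cryst β hβ α hα
    have e1 := hk
    have e2 := hk'
    rw [inner_coroot, real_inner_comm α β] at e1
    rw [inner_coroot, hβs] at e2
    have hkpos : (0:ℝ) < k := by rw [← e1]; positivity
    have hk1 : (1:ℤ) ≤ k := by exact_mod_cast hkpos
    have e3 : (k:ℝ) * ⟪α, α⟫ = k' * ⟪S.hs, S.hs⟫ := by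
      rw [← e1, ← e2]; field_simp
    have hkk : (k:ℝ) < k' := by
      by_contra hn
      push Not at hn
      nlinarith
    have hk2 : (2:ℤ) ≤ k' := by
      have : k < k' := by exact_mod_cast hkk
      omega
    have hk2' : (2:ℝ) ≤ k' := by exact_mod_cast hk2
    have hm := S.neg_mem' (S.refl_mem α hα β hβ)
    have s1 := short β hβ hβs
    have s2 := short _ hm (by rw [inner_neg_neg, refl_norm, hβs])
    rw [inner_neg_right, inner_sub_right, real_inner_smul_right, hk] at s2
    have s3 : (k:ℝ) * ⟪x, α⟫ ≤ 2 * ⟪x, S.hs⟫ := by linarith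
    have hxs : 0 ≤ ⟪x, S.hs⟫ := S.dom hx S.hs_mem
    have h5 : ⟪x, α⟫ * ⟪S.hs, S.hs⟫ ≤ ⟪x, S.hs⟫ * ⟪α, α⟫ := by
      have h6 : (k' : ℝ) * ⟪S.hs, S.hs⟫ * ⟪x, α⟫ ≤ 2 * ⟪x, S.hs⟫ * ⟪α, α⟫ := by
        rw [← e3]; nlinarith
      by_cases hneg : ⟪x, α⟫ ≤ 0
      · nlinarith [mul_nonneg hxs hα0.le]
      · push Not at hneg
        nlinarith [mul_pos hs0 hneg]
    rw [div_mul_eq_mul_div, div_mul_eq_mul_div, div_le_div_iff₀ hα0 hs0]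
    nlinarith

lemma eq_of_big {θ α : V} {N : ℝ} (h1 : ⟪θ, θ⟫ ≤ N) (h2 : ⟪α, α⟫ ≤ N) (h : N ≤ |⟪θ, α⟫|) :
    α = θ ∨ α = -θ := by
  rcases le_abs.mp h with h | h
  · left
    rw [← sub_eq_zero, ← real_inner_self_nonpos]
    rw [inner_sub_left, inner_sub_right, inner_sub_right, real_inner_comm θ α]
    linarith
  · right
    rw [← sub_eq_zero, ← real_inner_self_nonpos, sub_neg_eq_add]
    rw [inner_add_left, inner_add_right, inner_add_right, real_inner_comm θ α]
    linarith

/-- the combined facts on the hat map and the affine root -/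
structure Kap (κ : V → ℝ) : Prop where
  hat : ∀ α, S.hat α = κ α • α
  pos : ∀ α ∈ S.R0, 0 < κ α
  inv : ∀ α β : V, ⟪α, α⟫ = ⟪β, β⟫ → κ α = κ β
  a0 : κ S.a0 * ⟪S.a0, S.a0⟫ = 2
  int : ∀ α ∈ S.R0, ∃ k : ℤ, ⟪S.a0, S.hat α⟫ = k
  bd : ∀ α ∈ S.R0, α = S.a0 ∨ α = -S.a0 ∨ |⟪S.a0, S.hat α⟫| < 2
  neg_a0 : -S.a0 ∈ S.Rpos
  dom : ∀ α ∈ S.Rpos, ⟪S.a0, α⟫ ≤ 0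
  high : ∀ x, (∀ j, 0 ≤ ⟪x, S.simple j⟫) → ∀ α ∈ S.Rpos, ⟪x, S.hat α⟫ ≤ -⟪x, S.hat S.a0⟫

lemma exists_kap : ∃ κ, S.Kap κ := by
  rcases S.admissible with ⟨hh, ha⟩ | ⟨hh, ha⟩
  · have hhs := S.pos_subset S.hs_mem
    have h0 := S.inner_pos hhs
    refine ⟨fun α => 2 / ⟪α, α⟫, ⟨hh, fun α hα => ?_, fun α β h => by simp only [h], ?_, ?_, ?_, ?_,
      ?_, ?_⟩⟩
    · have := S.inner_pos hα; positivity
    · rw [ha, inner_neg_neg]; field_simp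
    · intro α hα
      obtain ⟨k, hk⟩ := S.cryst α hα _ hhs
      exact ⟨-k, by rw [ha, hh, inner_neg_left, hk]; simp⟩
    · intro α hα
      by_cases hb : |⟪S.a0, S.hat α⟫| < 2
      · exact Or.inr (Or.inr hb)
      · push Not at hb
        have hp := S.inner_pos hα
        rw [hh, inner_coroot, abs_mul, abs_of_pos (by positivity : 0 < 2 / ⟪α, α⟫),
          div_mul_eq_mul_div, le_div_iff₀ hp] at hb
        have := eq_of_big (θ := S.a0) (α := α) (N := ⟪α, α⟫)
          (by rw [ha, inner_neg_neg]; exact S.hs_short α hα) le_rfl (by linarith)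
        tauto
    · rw [ha, neg_neg]; exact S.hs_mem
    · intro α hα
      have := S.dom_of_highest S.hs_highest hhs hα
      rw [ha, inner_neg_left]; linarith
    · intro x hx α hα
      have := S.hs_coroot_highest hx (S.pos_subset hα)
      have e : coroot (-S.hs) = - coroot S.hs := by simp [coroot]
      rw [ha, hh, hh, e, inner_neg_right, neg_neg]; exact this
  · have hφ := S.pos_subset S.hroot_mem
    have h0 := S.inner_pos hφ
    refine ⟨fun α => 2 / ⟪S.hroot, S.hroot⟫, ⟨hh, fun α hα => ?_, fun α β h => rfl, ?_, ?_, ?_, ?_,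
      ?_, ?_⟩⟩
    · positivity
    · rw [ha, inner_neg_neg]; field_simp
    · intro α hα
      obtain ⟨k, hk⟩ := S.cryst _ hφ _ hα
      refine ⟨-k, ?_⟩
      rw [inner_coroot] at hk
      rw [ha, hh, inner_neg_left, real_inner_smul_right, real_inner_comm α, hk]; simp
    · intro α hα
      by_cases hb : |⟪S.a0, S.hat α⟫| < 2
      · exact Or.inr (Or.inr hb)
      · push Not at hb
        rw [hh, real_inner_smul_right, abs_mul,
          abs_of_pos (by positivity : 0 < 2 / ⟪S.hroot, S.hroot⟫),
          div_mul_eq_mul_div, le_div_iff₀ h0] at hb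
        have := eq_of_big (θ := S.a0) (α := α) (N := ⟪S.hroot, S.hroot⟫)
          (by rw [ha, inner_neg_neg]) (S.hroot_long hα) (by linarith)
        tauto
    · rw [ha, neg_neg]; exact S.hroot_mem
    · intro α hα
      have := S.dom_of_highest (fun β hβ _ => S.hroot_highest β hβ) hφ hα
      rw [ha, inner_neg_left]; linarith
    · intro x hx α hα
      obtain ⟨f, hf⟩ := S.hroot_highest α (S.pos_subset hα)
      have := S.inner_sum_nonneg hx f
      rw [← hf, inner_sub_right] at this
      rw [ha, hh, hh, smul_neg, inner_neg_right, neg_neg, real_inner_smul_right,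
        real_inner_smul_right]
      exact mul_le_mul_of_nonneg_left (by linarith) (by positivity)

end Setup

namespace Setup

variable (S : Setup V)

/-- normalized affine root function -/
def bval (p : V × ℤ) (x : V) : ℝ := ⟪x, S.hat p.1⟫ + (p.2 : ℝ) * (S.c : ℝ)

/-- affine reflection of a pair -/
def sref (p : V × ℤ) : Equiv.Perm V := reflP p.1 (S.m p.1 * (p.2 : ℝ) * (S.c : ℝ))

/-- simple affine root pairs -/
def pj (j : Fin (S.n + 1)) : V × ℤ := (S.alpha j, if (j : ℕ) = 0 then 1 else 0)

lemma c_pos : (0 : ℝ) < S.c := by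
  have := S.c_gt
  exact_mod_cast (by omega : 0 < S.c)


lemma m_eq {S : Setup V} {κ : V → ℝ} (hκ : S.Kap κ) (α : V) : S.m α = 2 / (κ α * ⟪α, α⟫) := by
  rw [m, hκ.hat, real_inner_smul_right]

lemma m_pos {S : Setup V} {κ : V → ℝ} (hκ : S.Kap κ) {α : V} (hα : α ∈ S.R0) : 0 < S.m α := by
  rw [m_eq hκ]
  have := hκ.pos α hα
  have := S.inner_pos hα
  positivity

lemma aval_eq {S : Setup V} {κ : V → ℝ} (hκ : S.Kap κ) {α : V} (hα : α ∈ S.R0) (x : V) (r : ℝ) :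
    ⟪x, coroot α⟫ + S.m α * r * (S.c : ℝ) = S.m α * (⟪x, S.hat α⟫ + r * S.c) := by
  rw [inner_coroot, m_eq hκ, hκ.hat, real_inner_smul_right]
  have := hκ.pos α hα
  have := S.inner_pos hα
  field_simp

lemma sref_apply {S : Setup V} {κ : V → ℝ} (hκ : S.Kap κ) {p : V × ℤ} (hp : p.1 ∈ S.R0) (x : V) :
    S.sref p x = x - S.bval p x • S.m p.1 • p.1 := by
  rw [sref, reflP_apply, aval_eq hκ hp, bval, smul_smul, mul_comm]

lemma coroot_hat {S : Setup V} {κ : V → ℝ} (hκ : S.Kap κ) {α : V} (hα : α ∈ S.R0) :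
    coroot (S.hat α) = S.m α • α := by
  rw [coroot, hκ.hat, m_eq hκ, real_inner_smul_right, real_inner_smul_left, smul_smul]
  have := hκ.pos α hα
  have := S.inner_pos hα
  congr 1
  field_simp

lemma act_val {S : Setup V} {κ : V → ℝ} (hκ : S.Kap κ) (α β : V) (r e : ℤ) (k : ℝ)
    (he : (e : ℝ) = k * ⟪β, S.hat α⟫) :
    S.bval (α - ⟪α, coroot β⟫ • β, r - e) = S.bval (α, r) ∘ reflP β (k * S.c) := by
  ext x
  have h1 := hκ.inv _ _ (refl_norm β α)
  simp only [bval, Function.comp_apply, reflP_apply]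
  rw [hκ.hat, h1, Int.cast_sub, he, hκ.hat]
  simp only [real_inner_smul_right, inner_sub_left, inner_sub_right, real_inner_smul_left,
    inner_coroot]
  rw [real_inner_comm β α]
  ring

lemma act_refl {S : Setup V} {κ : V → ℝ} (hκ : S.Kap κ) {α β : V} (hα : α ∈ S.R0) (hβ : β ∈ S.R0)
    (r e : ℤ) (k : ℝ) (he : (e : ℝ) = k * ⟪β, S.hat α⟫) :
    S.sref (α - ⟪α, coroot β⟫ • β, r - e) =
      reflP β (k * S.c) * S.sref (α, r) * reflP β (k * S.c) := by
  have hm : S.m (α - ⟪α, coroot β⟫ • β) = S.m α := by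
    rw [m_eq hκ, m_eq hκ, refl_norm, hκ.inv _ _ (refl_norm β α)]
  have hsub : ∀ (y v : V) (q : ℝ), reflP β q (y - v) = reflP β q y - (v - ⟪v, coroot β⟫ • β) := by
    intro y v q
    simp only [reflP_apply, inner_sub_left]
    module
  ext x
  rw [sref_apply hκ (S.refl_mem β hβ α hα), act_val hκ α β r e k he]
  simp only [Equiv.Perm.mul_apply]
  rw [sref_apply hκ (p := (α, r)) hα, hsub]
  have : reflP β (k * S.c) (reflP β (k * S.c) x) = x := refl_involutive β (k * S.c) x
  rw [this, hm]
  simp only [Function.comp_apply, real_inner_smul_left]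
  module

lemma alpha_zero (S : Setup V) {j : Fin (S.n + 1)} (h : (j : ℕ) = 0) :
    S.alpha j = S.a0 ∧ S.kconst j = S.c ∧ S.pj j = (S.a0, 1) := by
  simp [alpha, kconst, pj, h]

lemma alpha_succ (S : Setup V) {j : Fin (S.n + 1)} (h : (j : ℕ) ≠ 0) :
    ∃ i, S.alpha j = S.simple i ∧ S.kconst j = 0 ∧ S.pj j = (S.simple i, 0) := by
  simp [alpha, kconst, pj, h]

lemma pj_succ (S : Setup V) (i : Fin S.n) : S.pj i.succ = (S.simple i, 0) := by
  simp [alpha, pj]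

lemma pj_zero (S : Setup V) : S.pj 0 = (S.a0, 1) := by
  simp [alpha, pj]

lemma a0_mem {S : Setup V} {κ : V → ℝ} (hκ : S.Kap κ) : S.a0 ∈ S.R0 := by
  have := S.neg_mem' (S.pos_subset hκ.neg_a0)
  rwa [neg_neg] at this

lemma m_a0 {S : Setup V} {κ : V → ℝ} (hκ : S.Kap κ) : S.m S.a0 = 1 := by
  rw [m_eq hκ, hκ.a0]; norm_num

lemma sgen_eq {S : Setup V} {κ : V → ℝ} (hκ : S.Kap κ) (j : Fin (S.n + 1)) :
    S.sgen j = S.sref (S.pj j) := by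
  by_cases h : (j : ℕ) = 0
  · obtain ⟨h1, h2, h3⟩ := S.alpha_zero h
    rw [sgen, sref, h1, h2, h3]; simp [m_a0 hκ]
  · obtain ⟨i, h1, h2, h3⟩ := S.alpha_succ h
    rw [sgen, sref, h1, h2, h3]; simp

lemma pj_mem {S : Setup V} {κ : V → ℝ} (hκ : S.Kap κ) (j : Fin (S.n + 1)) :
    S.pj j ∈ S.RplusP := by
  by_cases h : (j : ℕ) = 0
  · obtain ⟨h1, h2, h3⟩ := S.alpha_zero h
    rw [h3]; exact ⟨a0_mem hκ, Or.inl le_rfl⟩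
  · obtain ⟨i, h1, h2, h3⟩ := S.alpha_succ h
    rw [h3]; exact ⟨S.pos_subset (S.simple_mem i), Or.inr ⟨rfl, S.simple_mem i⟩⟩

lemma simple_perm (S : Setup V) (i : Fin S.n) {α : V} (hα : α ∈ S.Rpos) :
    α = S.simple i ∨ α - ⟪α, coroot (S.simple i)⟫ • S.simple i ∈ S.Rpos := by
  by_cases hn : α - ⟪α, coroot (S.simple i)⟫ • S.simple i ∈ S.Rpos
  · exact Or.inr hn
  left
  have hi := S.pos_subset (S.simple_mem i)
  have h1 := (S.pos_or (S.refl_mem _ hi _ (S.pos_subset hα))).resolve_left hn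
  obtain ⟨f, hf⟩ := S.pos_decomp α hα
  obtain ⟨g, hg⟩ := S.pos_decomp _ h1
  have hsum : ∑ j, ((f j : ℝ) + g j - if j = i then ⟪α, coroot (S.simple i)⟫ else 0) •
      S.simple j = 0 := by
    simp only [sub_smul, add_smul, Finset.sum_sub_distrib, Finset.sum_add_distrib, ← hf, ← hg,
      ite_smul, zero_smul, Finset.sum_ite_eq', Finset.mem_univ, if_true]
    abel
  have hz := Fintype.linearIndependent_iff.mp S.linInd _ hsum
  have hf0 : ∀ j, j ≠ i → (f j : ℝ) = 0 := by
    intro j hj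
    have := hz j
    simp only [hj, if_false, sub_zero] at this
    have h2 : (0:ℝ) ≤ f j := Nat.cast_nonneg _
    have h3 : (0:ℝ) ≤ g j := Nat.cast_nonneg _
    linarith
  have hα' : α = (f i : ℝ) • S.simple i := by
    rw [hf]
    exact Finset.sum_eq_single i (fun j _ hj => by rw [hf0 j hj, zero_smul]) (by simp)
  rcases S.reduced _ hi (f i : ℝ) (hα' ▸ S.pos_subset hα) with h | h
  · rw [hα', h, one_smul]
  · have h2 : (0:ℝ) ≤ f i := Nat.cast_nonneg _
    linarith

lemma perm_aux {S : Setup V} {κ : V → ℝ} (hκ : S.Kap κ) (p : V × ℤ) (hp : p ∈ S.RplusP)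
    (j : Fin (S.n + 1)) : p = S.pj j ∨ ∃ q ∈ S.RplusP, S.bval q = S.bval p ∘ S.sgen j ∧
      S.sref q = S.sgen j * S.sref p * S.sgen j := by
  obtain ⟨α, r⟩ := p
  obtain ⟨hα, hr⟩ := hp
  simp only at hα hr
  by_cases h : (j : ℕ) = 0
  · obtain ⟨h1, h2, h3⟩ := S.alpha_zero h
    obtain ⟨k, hk⟩ := hκ.int α hα
    have ha0 := a0_mem hκ
    have hs : S.sgen j = reflP S.a0 (1 * S.c) := by rw [sgen, h1, h2, one_mul]
    rw [h3, hs]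
    have goal : (S.a0 = α ∧ r = 1) ∨
        (1 ≤ r - k ∨ (r - k = 0 ∧ α - ⟪α, coroot S.a0⟫ • S.a0 ∈ S.Rpos)) := by
      have ha0n : S.a0 ∉ S.Rpos := fun hc => ((S.pos_partition _ ha0).1 hc) hκ.neg_a0
      have hself : ⟪S.a0, S.hat S.a0⟫ = 2 := by
        rw [hκ.hat, real_inner_smul_right, hκ.a0]
      rcases hκ.bd α hα with rfl | rfl | hb
      · have hk2 : k = 2 := by exact_mod_cast hk.symm.trans hself
        have hr1 : 1 ≤ r := by tauto
        have h2 : ⟪S.a0, coroot S.a0⟫ = 2 := by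
          rw [real_inner_comm, inner_coroot_self (S.root_ne hα)]
        have h4 : S.a0 - (2:ℝ) • S.a0 = -S.a0 := by module
        rw [h2, h4]
        have := hκ.neg_a0
        rcases (by omega : r = 1 ∨ r - k = 0 ∨ 1 ≤ r - k) with h | h | h <;> tauto
      · have hk2 : k = -2 := by
          have e : S.hat (-S.a0) = - S.hat S.a0 := by
            rw [hκ.hat, hκ.hat, hκ.inv (-S.a0) S.a0 (by rw [inner_neg_neg]), smul_neg]
          rw [e, inner_neg_right, hself] at hk
          exact_mod_cast hk.symm
        right; left; omega
      · rw [hk] at hb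
        have hb' : |k| < 2 := by exact_mod_cast hb
        rw [abs_lt] at hb'
        have hke : (k : ℝ) = κ α * ⟪S.a0, α⟫ := by
          rw [← hk, hκ.hat, real_inner_smul_right]
        have hκp := hκ.pos α hα
        rcases hr with hr | ⟨hr, hpos⟩
        · by_cases hrk : 1 ≤ r - k
          · exact Or.inr (Or.inl hrk)
          have hrk0 : r - k = 0 := by omega
          refine Or.inr (Or.inr ⟨hrk0, ?_⟩)
          have hkpos : (0:ℝ) < k := by exact_mod_cast (by omega : 0 < k)
          have hip : 0 < ⟪S.a0, α⟫ := by
            rw [hke] at hkpos; exact pos_of_mul_pos_right hkpos hκp.le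
          rcases S.pos_or (S.refl_mem _ ha0 _ hα) with h | h
          · exact h
          · have h5 := hκ.dom _ h
            rw [inner_neg_right, inner_sub_right, real_inner_smul_right, inner_coroot,
              real_inner_comm S.a0 α] at h5
            have h6 := S.inner_pos ha0
            have h7 : 2 / ⟪S.a0, S.a0⟫ * ⟪S.a0, α⟫ * ⟪S.a0, S.a0⟫ = 2 * ⟪S.a0, α⟫ := by
              field_simp
            linarith
        · have h5 := hκ.dom α hpos
          have hk0 : (k : ℝ) ≤ 0 := by rw [hke]; exact mul_nonpos_of_nonneg_of_nonpos hκp.le h5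
          have hk0' : k ≤ 0 := by exact_mod_cast hk0
          rcases hk0'.lt_or_eq with h | h
          · right; left; omega
          · right; right
            refine ⟨by omega, ?_⟩
            have h8 : ⟪S.a0, α⟫ = 0 := by
              rw [h, Int.cast_zero] at hke
              exact (mul_eq_zero.mp hke.symm).resolve_left hκp.ne'
            rw [inner_coroot, real_inner_comm S.a0 α, h8]
            simpa using hpos
    rcases goal with ⟨rfl, rfl⟩ | goal
    · left; rfl
    · right
      exact ⟨(α - ⟪α, coroot S.a0⟫ • S.a0, r - k), ⟨S.refl_mem _ ha0 _ hα, goal⟩,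
        act_val hκ α S.a0 r k 1 (by rw [hk, one_mul]),
        act_refl hκ hα ha0 r k 1 (by rw [hk, one_mul])⟩
  · obtain ⟨i, h1, h2, h3⟩ := S.alpha_succ h
    have hi := S.pos_subset (S.simple_mem i)
    have hs : S.sgen j = reflP (S.simple i) (0 * S.c) := by rw [sgen, h1, h2, zero_mul]
    rw [h3, hs]
    have goal : (S.simple i = α ∧ r = 0) ∨
        (1 ≤ r - 0 ∨ (r - 0 = 0 ∧ α - ⟪α, coroot (S.simple i)⟫ • S.simple i ∈ S.Rpos)) := by
      rcases hr with hr | ⟨hr, hpos⟩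
      · right; left; omega
      · rcases S.simple_perm i hpos with h | h
        · left; exact ⟨h.symm, hr⟩
        · right; right; exact ⟨by omega, h⟩
    rcases goal with ⟨rfl, rfl⟩ | goal
    · left; rfl
    · right
      exact ⟨(α - ⟪α, coroot (S.simple i)⟫ • S.simple i, r - 0), ⟨S.refl_mem _ hi _ hα, goal⟩,
        act_val hκ α (S.simple i) r 0 0 (by simp),
        act_refl hκ hα hi r 0 0 (by simp)⟩

lemma hat_neg {S : Setup V} {κ : V → ℝ} (hκ : S.Kap κ) (α : V) : S.hat (-α) = - S.hat α := by
  rw [hκ.hat, hκ.hat, hκ.inv (-α) α (by rw [inner_neg_neg]), smul_neg]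

lemma alc_iff {S : Setup V} {κ : V → ℝ} (hκ : S.Kap κ) (x : V) :
    x ∈ S.Alc ↔ ∀ j, 0 ≤ S.bval (S.pj j) x := by
  constructor
  · intro hx j
    by_cases h : (j : ℕ) = 0
    · obtain ⟨h1, h2, h3⟩ := S.alpha_zero h
      have := (hx _ hκ.neg_a0).2
      rw [hat_neg hκ, inner_neg_right] at this
      rw [h3, bval]; simp only [Int.cast_one, one_mul]; linarith
    · obtain ⟨i, h1, h2, h3⟩ := S.alpha_succ h
      have := (hx _ (S.simple_mem i)).1
      rw [h3, bval]; simpa using this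
  · intro hx α hα
    have hd : ∀ j, 0 ≤ ⟪x, S.simple j⟫ := by
      intro i
      have h1 := hx i.succ
      rw [pj_succ, bval, hκ.hat, real_inner_smul_right] at h1
      simp only [Int.cast_zero, zero_mul, add_zero] at h1
      have h2 := hκ.pos _ (S.pos_subset (S.simple_mem i))
      exact nonneg_of_mul_nonneg_right h1 h2
    refine ⟨?_, ?_⟩
    · rw [hκ.hat, real_inner_smul_right]
      exact mul_nonneg (hκ.pos _ (S.pos_subset hα)).le (S.dom hd hα)
    · have h1 := hκ.high x hd α hα
      have h2 := hx 0
      rw [pj_zero, bval] at h2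
      simp only [Int.cast_one, one_mul] at h2
      linarith

lemma exists_o {S : Setup V} {κ : V → ℝ} (hκ : S.Kap κ) :
    ∃ o : V, ∀ p ∈ S.RplusP, 0 < S.bval p o := by
  obtain ⟨d, hd⟩ := S.exists_d
  have hc := S.c_pos
  have hpos : ∀ α ∈ S.Rpos, 0 < ⟪d, S.hat α⟫ := by
    intro α hα
    rw [hκ.hat, real_inner_smul_right]
    exact mul_pos (hκ.pos _ (S.pos_subset hα)) (S.pos_d hd hα)
  set M := 1 + ∑ α ∈ S.Rpos, ⟪d, S.hat α⟫ with hM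
  have hMle : ∀ α ∈ S.Rpos, ⟪d, S.hat α⟫ < M := by
    intro α hα
    have := Finset.single_le_sum (f := fun α => ⟪d, S.hat α⟫) (fun a ha => (hpos a ha).le) hα
    linarith
  have hM0 : 0 < M := by
    have := Finset.sum_nonneg (fun a ha => (hpos a ha).le)
    linarith
  have hlt : ∀ α ∈ S.Rpos, ⟪(S.c / M) • d, S.hat α⟫ < S.c ∧ 0 < ⟪(S.c / M) • d, S.hat α⟫ := by
    intro α hα
    rw [real_inner_smul_left]
    refine ⟨?_, mul_pos (by positivity) (hpos α hα)⟩
    rw [div_mul_eq_mul_div, div_lt_iff₀ hM0]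
    exact mul_lt_mul_of_pos_left (hMle α hα) hc
  refine ⟨(S.c / M) • d, ?_⟩
  rintro ⟨α, r⟩ ⟨hα, hr⟩
  simp only at hα hr
  simp only [bval]
  rcases hr with hr | ⟨rfl, hr⟩
  · have hr' : (1:ℝ) ≤ r := by exact_mod_cast hr
    have hrc : (S.c : ℝ) ≤ r * S.c := by nlinarith
    rcases S.pos_or hα with h | h
    · have := hlt α h; linarith
    · have := hlt _ h
      rw [hat_neg hκ, inner_neg_right] at this
      linarith
  · have := hlt α hr
    simp only [Int.cast_zero, zero_mul, add_zero]; linarith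

lemma nonneg_alc {S : Setup V} {κ : V → ℝ} (hκ : S.Kap κ) {p : V × ℤ} (hp : p ∈ S.RplusP) {x : V}
    (hx : x ∈ S.Alc) : 0 ≤ S.bval p x := by
  obtain ⟨α, r⟩ := p
  obtain ⟨hα, hr⟩ := hp
  have hc := S.c_pos
  simp only at hα hr
  simp only [bval]
  rcases hr with hr | ⟨rfl, hr⟩
  · have hr' : (1:ℝ) ≤ r := by exact_mod_cast hr
    have hrc : (S.c : ℝ) ≤ r * S.c := by nlinarith
    rcases S.pos_or hα with h | h
    · have := hx α h; linarith
    · have := hx _ h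
      rw [hat_neg hκ, inner_neg_right] at this
      linarith
  · have := hx α hr
    simp only [Int.cast_zero, zero_mul, add_zero]; linarith

lemma fin_neg (S : Setup V) (x : V) : {p | p ∈ S.RplusP ∧ S.bval p x < 0}.Finite := by
  have hc := S.c_pos
  have h1 : (⋃ α ∈ S.R0, (fun r : ℤ => (α, r)) '' Set.Icc 0 ⌈-⟪x, S.hat α⟫ / S.c⌉).Finite :=
    S.R0.finite_toSet.biUnion fun α _ => (Set.finite_Icc _ _).image _
  refine h1.subset ?_
  rintro ⟨α, r⟩ ⟨⟨hα, hr⟩, hb⟩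
  simp only at hα hr
  simp only [bval] at hb
  simp only [Set.mem_iUnion]
  refine ⟨α, hα, r, ⟨by omega, ?_⟩, rfl⟩
  have h2 : (r : ℝ) ≤ -⟪x, S.hat α⟫ / S.c := by
    rw [le_div_iff₀ hc]; linarith
  exact_mod_cast h2.trans (Int.le_ceil _)

/-- The abstract geometry attached to a setup. -/
def geo (S : Setup V) {κ : V → ℝ} (hκ : S.Kap κ) : Geo V (Fin (S.n + 1)) where
  s := S.sgen
  b := fun j => S.bval (S.pj j)
  Pos := {q | ∃ p ∈ S.RplusP, q = (S.bval p, S.sref p)}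
  o := Classical.choose (exists_o hκ)
  b_mem := fun j => ⟨S.pj j, pj_mem hκ j, by rw [sgen_eq hκ]⟩
  perm := by
    rintro f g j ⟨p, hp, he⟩
    obtain ⟨rfl, rfl⟩ := Prod.mk.inj he
    rcases perm_aux hκ p hp j with rfl | ⟨q, hq, h1, h2⟩
    · right; exact ⟨rfl, (sgen_eq hκ j).symm⟩
    · left; exact ⟨q, hq, by rw [h1, h2]⟩
  pos_o := by
    rintro f g ⟨p, hp, he⟩
    obtain ⟨rfl, rfl⟩ := Prod.mk.inj he
    exact Classical.choose_spec (exists_o hκ) p hp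
  nonneg := by
    rintro f g x ⟨p, hp, he⟩ hx
    obtain ⟨rfl, rfl⟩ := Prod.mk.inj he
    exact nonneg_alc hκ hp ((alc_iff hκ x).2 hx)
  fin := by
    intro x
    refine ((S.fin_neg x).image S.bval).subset ?_
    rintro f ⟨g, ⟨p, hp, he⟩, hf⟩
    obtain ⟨rfl, rfl⟩ := Prod.mk.inj he
    exact ⟨p, ⟨hp, hf⟩, rfl⟩
  refl := by
    rintro f g ⟨p, hp, he⟩
    obtain ⟨rfl, rfl⟩ := Prod.mk.inj he
    refine ⟨S.hat p.1, p.2 * S.c, ?_, fun x => rfl, fun x => ?_⟩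
    · rw [hκ.hat]
      exact smul_ne_zero (hκ.pos _ hp.1).ne' (S.root_ne hp.1)
    · rw [sref_apply hκ hp.1, coroot_hat hκ hp.1]

end Setup

namespace Setup

lemma geo_alc (S : Setup V) {κ : V → ℝ} (hκ : S.Kap κ) (x : V) : x ∈ (S.geo hκ).Alc ↔ x ∈ S.Alc :=
  (alc_iff hκ x).symm

lemma sgen_mem_W {S : Setup V} {κ : V → ℝ} (hκ : S.Kap κ) (j : Fin (S.n + 1)) : S.sgen j ∈ S.W := by
  rw [sgen_eq hκ]
  exact Subgroup.subset_closure ⟨_, (pj_mem hκ j).1, _, rfl⟩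

lemma word_mem_W {S : Setup V} {κ : V → ℝ} (hκ : S.Kap κ) (l : List (Fin (S.n + 1))) :
    (l.map S.sgen).prod ∈ S.W := by
  apply Subgroup.list_prod_mem
  intro w hw
  obtain ⟨j, -, rfl⟩ := List.mem_map.mp hw
  exact sgen_mem_W hκ j

lemma exists_word_W {S : Setup V} {κ : V → ℝ} (hκ : S.Kap κ) {w : Equiv.Perm V} (hw : w ∈ S.W) :
    ∃ l : List (Fin (S.n + 1)), (l.map S.sgen).prod = w := by
  induction hw using Subgroup.closure_induction with
  | mem w hw =>
    obtain ⟨α, hα, r, rfl⟩ := hw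
    have key : ∀ p ∈ S.RplusP, ∃ l : List (Fin (S.n + 1)), (l.map S.sgen).prod = S.sref p := by
      intro p hp
      obtain ⟨l, hl⟩ := (S.geo hκ).gen (f := S.bval p) (g := S.sref p) ⟨p, hp, rfl⟩
      exact ⟨l, hl.symm⟩
    by_cases hp : (α, r) ∈ S.RplusP
    · exact key _ hp
    · have hn : (-α, -r) ∈ S.RplusP := by
        refine ⟨S.neg_mem' hα, ?_⟩
        have h1 : ¬ (1 ≤ r ∨ (r = 0 ∧ α ∈ S.Rpos)) := fun h => hp ⟨hα, h⟩
        push Not at h1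
        simp only
        rcases (by omega : r = 0 ∨ 1 ≤ -r) with h | h
        · right; exact ⟨by omega, (S.pos_or hα).resolve_left (h1.2 h)⟩
        · left; exact h
      obtain ⟨l, hl⟩ := key _ hn
      refine ⟨l, hl.trans ?_⟩
      have hm : S.m (-α) = S.m α := by
        rw [m_eq hκ, m_eq hκ, inner_neg_neg, hκ.inv (-α) α (by rw [inner_neg_neg])]
      have hcr : coroot (-α) = - coroot α := by simp [coroot]
      ext x
      simp only [sref, reflP_apply, hm, hcr, inner_neg_right]
      push_cast
      module
  | one => exact ⟨[], by simp⟩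
  | mul x y _ _ hx hy =>
    obtain ⟨l, rfl⟩ := hx
    obtain ⟨l', rfl⟩ := hy
    exact ⟨l ++ l', by simp⟩
  | inv x _ hx =>
    obtain ⟨l, rfl⟩ := hx
    refine ⟨l.reverse, ?_⟩
    rw [List.prod_inv_reverse, List.map_map, List.map_reverse]
    congr 2

lemma exists_reduced {S : Setup V} {κ : V → ℝ} (hκ : S.Kap κ) {w : Equiv.Perm V} (hw : w ∈ S.W) :
    ∃ l, S.IsReducedWord l w := by
  obtain ⟨l, hl⟩ := exists_word_W hκ hw
  have hne : {k | ∃ l : List (Fin (S.n + 1)), l.length = k ∧ (l.map S.sgen).prod = w}.Nonempty :=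
    ⟨_, l, rfl, hl⟩
  obtain ⟨l', h1, h2⟩ := Nat.sInf_mem hne
  exact ⟨l', h2, h1⟩

lemma pt_eq (S : Setup V) {κ : V → ℝ} (hκ : S.Kap κ) {l : List (Fin (S.n + 1))} {w : Equiv.Perm V}
    (h : (l.map S.sgen).prod = w) (y : V) : (S.geo hκ).pt l (w y) = y := by
  subst h
  show ((l.map S.sgen).prod)⁻¹ _ = y
  simp

section
variable {S : Setup V} {κ : V → ℝ} {wmin : V → Equiv.Perm V}

lemma wmin_of_SP (hκ : S.Kap κ) (hw : S.IsShortest wmin) {l : List (Fin (S.n + 1))} {x : V}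
    (hx : x ∈ S.Alc) (hl : (S.geo hκ).SP l x) :
    (l.map S.sgen).prod = wmin ((S.geo hκ).pt l x) ∧
      l.length = S.len (wmin ((S.geo hκ).pt l x)) := by
  set y := (S.geo hκ).pt l x with hy
  obtain ⟨h1, h2, h3⟩ := hw y
  obtain ⟨m, hm1, hm2⟩ := exists_reduced hκ h1
  have hu : (l.map S.sgen).prod y = x := by
    rw [hy]
    show (l.map S.sgen).prod (((l.map S.sgen).prod)⁻¹ x) = x
    simp
  obtain ⟨h4, h5⟩ := h3 _ (word_mem_W hκ l) (by rw [hu]; exact hx)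
  have h6 : S.len (l.map S.sgen).prod ≤ l.length := Nat.sInf_le ⟨l, rfl, rfl⟩
  have h7 := (S.geo hκ).N_pt_le m (wmin y y)
  rw [S.pt_eq hκ hm1, (S.geo hκ).N_alc ((S.geo_alc hκ _).2 h2)] at h7
  have h8 := (S.geo hκ).N_pt_ge l x hl
  rw [← hy] at h8
  exact ⟨h5 (by omega), by omega⟩

lemma SP_of_reduced (hκ : S.Kap κ) (hw : S.IsShortest wmin) {l : List (Fin (S.n + 1))} {y : V}
    (hl : S.IsReducedWord l (wmin y)) : (S.geo hκ).SP l (wmin y y) := by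
  obtain ⟨h1, h2, h3⟩ := hw y
  obtain ⟨l', a, b, c⟩ := (S.geo hκ).exists_SP _ l (wmin y y) le_rfl ((S.geo_alc hκ _).2 h2)
  rw [S.pt_eq hκ hl.1] at c
  have h4 := (wmin_of_SP hκ hw h2 b).2
  rw [c, ← hl.2] at h4
  rwa [a.eq_of_length h4] at b

lemma D_subset_bra (hκ : S.Kap κ) (hw : S.IsShortest wmin) {l : List (Fin (S.n + 1))} {y : V}
    (hl : S.IsReducedWord l (wmin y)) : (S.geo hκ).D l (wmin y y) ⊆ S.bra wmin y := by
  rintro z ⟨l', hl', rfl⟩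
  obtain ⟨h1, h2, h3⟩ := hw y
  obtain ⟨l2, a, b, c⟩ := (S.geo hκ).exists_SP _ l' (wmin y y) le_rfl ((S.geo_alc hκ _).2 h2)
  rw [← c]
  obtain ⟨h4, h5⟩ := wmin_of_SP hκ hw h2 b
  refine ⟨?_, l, hl, l2, a.trans hl', h4⟩
  rw [← h4]
  show (l2.map S.sgen).prod (((l2.map S.sgen).prod)⁻¹ _) = _
  simp

lemma mem_D_of_bra (hκ : S.Kap κ) {y z : V} (hz : z ∈ S.bra wmin y) :
    ∃ l, S.IsReducedWord l (wmin y) ∧ z ∈ (S.geo hκ).D l (wmin y y) := by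
  obtain ⟨h1, l, hl, l', hl', he⟩ := hz
  refine ⟨l, hl, l', hl', ?_⟩
  rw [← h1, S.pt_eq hκ he]

lemma RC_bra (hκ : S.Kap κ) (hw : S.IsShortest wmin) (y : V) : (S.geo hκ).RC (S.bra wmin y) := by
  intro f g z h hz hf
  obtain ⟨l, hl, hz⟩ := mem_D_of_bra hκ hz
  exact D_subset_bra hκ hw hl ((S.geo hκ).RC_D l _ ((S.geo_alc hκ _).2 (hw y).2.1) f g z h hz hf)

lemma preceq_of_mem (hκ : S.Kap κ) (hw : S.IsShortest wmin) {μ lam : V} (hQ : lam - μ ∈ S.Qlat)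
    (hμ : μ ∈ convexHull ℝ (S.bra wmin lam)) : S.preceq wmin μ lam := by
  refine ⟨hQ, convexHull_min ?_ (convex_convexHull _ _)⟩
  intro z hz
  obtain ⟨l, hl, hz⟩ := mem_D_of_bra hκ hz
  refine (S.geo hκ).D_subset_of_RC l _ _ ((S.geo hκ).RC_convexHull (RC_bra hκ hw lam))
    (SP_of_reduced hκ hw hl) ?_ hz
  rwa [S.pt_eq hκ hl.1]

lemma D_subset_ball (hκ : S.Kap κ) (hw : S.IsShortest wmin) {l : List (Fin (S.n + 1))} {y : V}
    (hl : S.IsReducedWord l (wmin y)) : (S.geo hκ).D l (wmin y y) ⊆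
      {z | z = y ∨ dist z (S.geo hκ).o < dist y (S.geo hκ).o} := by
  apply (S.geo hκ).D_subset_of_RC l _ _ ((S.geo hκ).RC_ball y) (SP_of_reduced hκ hw hl)
  left
  exact S.pt_eq hκ hl.1 y

lemma mem_of_preceq (hκ : S.Kap κ) (hw : S.IsShortest wmin) {μ lam : V}
    (h : S.preceq wmin μ lam) : μ ∈ Metric.closedBall (S.geo hκ).o (dist lam (S.geo hκ).o) := by
  have h1 : μ ∈ S.bra wmin μ := by
    obtain ⟨l, hl⟩ := exists_reduced hκ (hw μ).1
    exact ⟨rfl, l, hl, l, List.Sublist.refl l, hl.1⟩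
  have h2 := h.2 (subset_convexHull ℝ _ h1)
  refine convexHull_min ?_ (convex_closedBall _ _) h2
  intro z hz
  obtain ⟨l, hl, hz⟩ := mem_D_of_bra hκ hz
  rw [Metric.mem_closedBall]
  rcases D_subset_ball hκ hw hl hz with rfl | h
  · exact le_rfl
  · exact h.le

end

lemma Plat_finite (S : Setup V) (o : V) (R : ℝ) :
    {μ : V | μ ∈ S.Plat ∧ μ ∈ Metric.closedBall o R}.Finite := by
  let Φ : V → (Fin S.n → ℝ) := fun x j => ⟪x, coroot (S.simple j)⟫
  have hinj : Function.Injective Φ := by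
    intro x y h
    rw [← sub_eq_zero, ← inner_self_eq_zero (𝕜 := ℝ)]
    have : ∀ z ∈ Submodule.span ℝ (Set.range S.simple), ⟪x - y, z⟫ = 0 := by
      intro z hz
      induction hz using Submodule.span_induction with
      | mem z hz =>
        obtain ⟨j, rfl⟩ := hz
        have h1 := congrFun h j
        simp only [Φ, inner_coroot] at h1
        have h2 := S.inner_pos (S.pos_subset (S.simple_mem j))
        rw [inner_sub_left, sub_eq_zero]
        exact mul_left_cancel₀ (by positivity) h1
      | zero => simp
      | add a b _ _ ha hb => rw [inner_add_right, ha, hb, add_zero]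
      | smul r a _ ha => rw [real_inner_smul_right, ha, mul_zero]
    exact this _ (S.span_simple trivial)
  let B : Fin S.n → ℝ := fun j => (‖o‖ + R) * ‖coroot (S.simple j)‖
  have hfin : (Set.pi Set.univ (fun j : Fin S.n =>
      ((fun k : ℤ => (k : ℝ)) '' Set.Icc (-⌈B j⌉) ⌈B j⌉))).Finite :=
    Set.Finite.pi fun j => (Set.finite_Icc _ _).image _
  refine (hfin.preimage (hinj.injOn)).subset ?_
  rintro μ ⟨hμ, hb⟩ j -
  obtain ⟨k, hk⟩ := hμ _ (S.pos_subset (S.simple_mem j))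
  refine ⟨k, ?_, hk.symm⟩
  have h1 := abs_real_inner_le_norm μ (coroot (S.simple j))
  have h2 : ‖μ‖ ≤ ‖o‖ + R := by
    rw [Metric.mem_closedBall, dist_eq_norm] at hb
    have := norm_le_norm_add_norm_sub' μ o
    linarith
  have h3 : |(k : ℝ)| ≤ B j := by
    rw [← hk]
    exact h1.trans (mul_le_mul_of_nonneg_right h2 (norm_nonneg _))
  have h4 : |(k : ℝ)| ≤ ⌈B j⌉ := h3.trans (Int.le_ceil _)
  have h5 : |k| ≤ ⌈B j⌉ := by exact_mod_cast h4
  rw [abs_le] at h5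
  exact h5

lemma Plat_sub (S : Setup V) {x α : V} (hx : x ∈ S.Plat) (hα : α ∈ S.R0) (k : ℤ) :
    x - (k : ℝ) • α ∈ S.Plat ∧ x - (x - (k : ℝ) • α) ∈ S.Qlat := by
  constructor
  · intro β hβ
    obtain ⟨a, ha⟩ := hx β hβ
    obtain ⟨b, hb⟩ := S.cryst β hβ α hα
    refine ⟨a - k * b, ?_⟩
    rw [inner_sub_left, real_inner_smul_left, ha, hb]; push_cast; ring
  · rw [sub_sub_cancel, Int.cast_smul_eq_zsmul]
    exact AddSubgroup.zsmul_mem _ (AddSubgroup.subset_closure hα) k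

lemma Q_trans (S : Setup V) {x y z : V} (h1 : x - y ∈ S.Qlat) (h2 : y - z ∈ S.Qlat) :
    x - z ∈ S.Qlat := by
  have := AddSubgroup.add_mem _ h1 h2
  rwa [sub_add_sub_cancel] at this

lemma alpha_mem {S : Setup V} {κ : V → ℝ} (hκ : S.Kap κ) (j : Fin (S.n + 1)) : S.alpha j ∈ S.R0 :=
  (pj_mem hκ j).1

lemma aFun_int {S : Setup V} {κ : V → ℝ} (hκ : S.Kap κ) (j : Fin (S.n + 1)) {x : V}
    (hx : x ∈ S.Plat) : ∃ a : ℤ, S.aFun j x = a := by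
  obtain ⟨k, hk⟩ := hx _ (alpha_mem hκ j)
  by_cases h : (j : ℕ) = 0
  · exact ⟨k + S.c, by rw [aFun, hk, kconst, if_pos h]; push_cast; rfl⟩
  · exact ⟨k, by rw [aFun, hk, kconst, if_neg h, add_zero]⟩

lemma sgen_apply (S : Setup V) (j : Fin (S.n + 1)) (x : V) :
    S.sgen j x = x - S.aFun j x • S.alpha j := rfl

lemma aFun_eq {S : Setup V} {κ : V → ℝ} (hκ : S.Kap κ) (j : Fin (S.n + 1)) (x : V) :
    S.aFun j x = S.m (S.alpha j) * (S.geo hκ).b j x := by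
  show _ = S.m (S.alpha j) * S.bval (S.pj j) x
  have := aval_eq hκ (alpha_mem hκ j) x ((S.pj j).2 : ℝ)
  rw [bval]
  refine Eq.trans ?_ this
  rw [aFun]
  congr 1
  by_cases h : (j : ℕ) = 0
  · obtain ⟨h1, h2, h3⟩ := S.alpha_zero h
    rw [h2, h1, h3, m_a0 hκ]; simp
  · obtain ⟨i, h1, h2, h3⟩ := S.alpha_succ h
    rw [h2, h3]; simp

lemma word_Plat {S : Setup V} {κ : V → ℝ} (hκ : S.Kap κ) (l : List (Fin (S.n + 1))) {x : V}
    (hx : x ∈ S.Plat) :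
    (l.map S.sgen).prod x ∈ S.Plat ∧ x - (l.map S.sgen).prod x ∈ S.Qlat := by
  induction l with
  | nil => simpa [Qlat] using hx
  | cons j l ih =>
    obtain ⟨h1, h2⟩ := ih
    simp only [List.map_cons, List.prod_cons, Equiv.Perm.mul_apply]
    obtain ⟨a, ha⟩ := aFun_int hκ j h1
    rw [sgen_apply, ha]
    obtain ⟨h3, h4⟩ := S.Plat_sub h1 (alpha_mem hκ j) a
    exact ⟨h3, S.Q_trans h2 h4⟩

lemma Top_eq {S : Setup V} {κ : V → ℝ} (hκ : S.Kap κ) (j : Fin (S.n + 1)) {x : V}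
    (hx : x ∈ S.Plat) {a : ℤ} (ha : S.aFun j x = a) (g : ↥S.Plat → ℂ) :
    S.ev (S.Top j g) x = (S.t (S.alpha j) : ℂ) * S.ev g (x - (a : ℝ) • S.alpha j) +
      ((S.t (S.alpha j) : ℂ) - 1) * (if 0 < a then
        -∑ k ∈ Finset.Icc (1 : ℤ) a, S.ev g (x - (k : ℝ) • S.alpha j)
      else if a < 0 then
        ∑ k ∈ Finset.Icc (0 : ℤ) (-a - 1), S.ev g (x - ((-k : ℤ) : ℝ) • S.alpha j)
      else 0) := by
  have hinv : (S.sgen j)⁻¹ x = x - (a : ℝ) • S.alpha j := by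
    have : (S.sgen j)⁻¹ = S.sgen j := (S.geo hκ).s_inv j
    rw [this, sgen_apply, ha]
  rw [ev, dif_pos hx, Top, hinv, Jop]
  simp only [ha, Int.floor_intCast, Int.cast_neg, neg_smul, sub_neg_eq_add]

/-- evaluation functional -/
def E (S : Setup V) (η : V) : (↥S.Plat → ℂ) → ℂ := fun f => S.ev f η

/-- span of evaluation functionals -/
def Sp (S : Setup V) (A : Set V) : Submodule ℂ ((↥S.Plat → ℂ) → ℂ) :=
  Submodule.span ℂ (S.E '' A)

lemma Sp_mono (S : Setup V) {A B : Set V} (h : A ⊆ B) : S.Sp A ≤ S.Sp B :=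
  Submodule.span_mono (Set.image_mono h)

/-- support sets -/
def supp (S : Setup V) {κ : V → ℝ} (hκ : S.Kap κ) (l : List (Fin (S.n + 1))) (x : V) : Set V :=
  {η | η ∈ S.Plat ∧ x - η ∈ S.Qlat ∧ η ∈ convexHull ℝ ((S.geo hκ).D l x)}

lemma supp_step {S : Setup V} {κ : V → ℝ} (hκ : S.Kap κ) (j : Fin (S.n + 1))
    (l : List (Fin (S.n + 1))) {x : V}
    (hx : x ∈ S.Plat) {a : ℤ} (ha : S.aFun j x = a) (k : ℤ) (hk : (0 ≤ k ∧ k ≤ a) ∨ (a ≤ k ∧ k ≤ 0)) :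
    S.supp hκ l (x - (k : ℝ) • S.alpha j) ⊆ S.supp hκ (j :: l) x := by
  rintro η ⟨h1, h2, h3⟩
  obtain ⟨h4, h5⟩ := S.Plat_sub hx (alpha_mem hκ j) k
  refine ⟨h1, S.Q_trans h5 h2, ?_⟩
  obtain ⟨τ, ht0, ht1, htk⟩ : ∃ τ : ℝ, 0 ≤ τ ∧ τ ≤ 1 ∧ (k : ℝ) = τ * a := by
    by_cases ha0 : a = 0
    · exact ⟨0, le_rfl, zero_le_one, by
        have : k = 0 := by omega
        simp [this]⟩
    · have ha0' : (a : ℝ) ≠ 0 := by exact_mod_cast ha0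
      refine ⟨k / a, ?_, ?_, by field_simp⟩
      · rcases hk with ⟨h, h'⟩ | ⟨h, h'⟩
        · exact div_nonneg (by exact_mod_cast h) (by exact_mod_cast h.trans h')
        · exact div_nonneg_of_nonpos (by exact_mod_cast h') (by exact_mod_cast h.trans h')
      · rcases hk with ⟨h, h'⟩ | ⟨h, h'⟩
        · have : (0:ℝ) < a := by exact_mod_cast (by omega : 0 < a)
          rw [div_le_one this]; exact_mod_cast h'
        · have : (a:ℝ) < 0 := by exact_mod_cast (by omega : a < 0)
          rw [div_le_one_of_neg this]; exact_mod_cast h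
  have hz : x - (k : ℝ) • S.alpha j = (1 - τ) • x + τ • S.sgen j x := by
    rw [sgen_apply, ha, htk]; module
  refine convexHull_min ?_ (convex_convexHull _ _) h3
  rintro y ⟨l', hl', rfl⟩
  rw [hz, (S.geo hκ).pt_aff l' _ _ _ _ (by ring)]
  exact convex_convexHull ℝ _
    (subset_convexHull ℝ _ ((S.geo hκ).D_cons_left l j x ⟨l', hl', rfl⟩))
    (subset_convexHull ℝ _ ((S.geo hκ).D_cons_right l j x ⟨l', hl', rfl⟩))
    (by linarith) ht0 (by ring)

lemma expand {S : Setup V} {κ : V → ℝ} (hκ : S.Kap κ) (l : List (Fin (S.n + 1))) :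
    ∀ x ∈ S.Plat, (fun f => S.ev (S.wordOp l f) x) ∈ S.Sp (S.supp hκ l x) := by
  induction l with
  | nil =>
    intro x hx
    refine Submodule.subset_span ⟨x, ⟨hx, ?_, ?_⟩, rfl⟩
    · rw [sub_self]; exact AddSubgroup.zero_mem _
    · exact subset_convexHull ℝ _ ⟨[], List.Sublist.refl _, by simp⟩
  | cons j l ih =>
    intro x hx
    obtain ⟨a, ha⟩ := aFun_int hκ j hx
    have term : ∀ k : ℤ, (0 ≤ k ∧ k ≤ a) ∨ (a ≤ k ∧ k ≤ 0) →
        (fun f => S.ev (S.wordOp l f) (x - (k : ℝ) • S.alpha j)) ∈ S.Sp (S.supp hκ (j :: l) x) :=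
      fun k hk => S.Sp_mono (supp_step hκ j l hx ha k hk)
        (ih _ (S.Plat_sub hx (alpha_mem hκ j) k).1)
    have hw : ∀ f, S.wordOp (j :: l) f = S.Top j (S.wordOp l f) := fun f => rfl
    simp only [hw, Top_eq hκ j hx ha]
    refine Submodule.add_mem _ (Submodule.smul_mem _ (S.t (S.alpha j) : ℂ) (term a (by omega)))
      (Submodule.smul_mem _ ((S.t (S.alpha j) : ℂ) - 1)
        (x := fun f => _) ?_)
    by_cases h1 : 0 < a
    · simp only [h1, if_true]
      refine Submodule.neg_mem _ (x := fun f => _) ?_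
      have := Submodule.sum_mem (S.Sp (S.supp hκ (j :: l) x)) (t := Finset.Icc (1 : ℤ) a)
        (f := fun k f => S.ev (S.wordOp l f) (x - (k : ℝ) • S.alpha j))
        (fun k hk => term k (by rw [Finset.mem_Icc] at hk; omega))
      convert this using 1
      ext f; simp
    · by_cases h2 : a < 0
      · simp only [h1, if_false, h2, if_true]
        have := Submodule.sum_mem (S.Sp (S.supp hκ (j :: l) x)) (t := Finset.Icc (0 : ℤ) (-a - 1))
          (f := fun k f => S.ev (S.wordOp l f) (x - ((-k : ℤ) : ℝ) • S.alpha j))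
          (fun k hk => term (-k) (by rw [Finset.mem_Icc] at hk; omega))
        convert this using 1
        ext f; simp
      · simp only [h1, h2, if_false]
        exact Submodule.zero_mem _

lemma diag {S : Setup V} {κ : V → ℝ} (hκ : S.Kap κ) (lam : V) (l : List (Fin (S.n + 1))) :
    ∀ x ∈ S.Plat, (S.geo hκ).SP l x → (S.geo hκ).pt l x = lam →
      (S.geo hκ).D l x ⊆ {z | z = lam ∨ dist z (S.geo hκ).o < dist lam (S.geo hκ).o} →
      (fun f => S.ev (S.wordOp l f) x - S.ev f lam) ∈
        S.Sp {z | dist z (S.geo hκ).o < dist lam (S.geo hκ).o} := by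
  induction l with
  | nil =>
    intro x hx _ hp _
    rw [Geo.pt_nil] at hp
    subst hp
    have hw : ∀ f, S.wordOp [] f = f := fun f => rfl
    simp only [hw, sub_self]
    exact Submodule.zero_mem _
  | cons j l ih =>
    intro x hx hs hp hD
    obtain ⟨a, ha⟩ := aFun_int hκ j hx
    have hapos : 0 < a := by
      have h1 := aFun_eq hκ j x
      have h2 : 0 < S.aFun j x := by
        rw [h1]; exact mul_pos (m_pos hκ (alpha_mem hκ j)) hs.1
      rw [ha] at h2
      exact_mod_cast h2
    have hsx : (S.geo hκ).s j x = x - (a : ℝ) • S.alpha j := by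
      rw [← ha]; rfl
    have hxP := (S.Plat_sub hx (alpha_mem hκ j) a).1
    rw [Geo.pt_cons] at hp
    have main := ih ((S.geo hκ).s j x) (by rw [hsx]; exact hxP) hs.2 hp
      (((S.geo hκ).D_cons_right l j x).trans hD)
    rw [hsx] at main
    have hne : x ≠ (S.geo hκ).s j x := by
      rw [hsx]
      intro h
      have h3 : (a : ℝ) • S.alpha j = 0 := by
        have := congrArg (fun z => x - z) h
        simpa using this.symm
      rcases smul_eq_zero.mp h3 with h | h
      · exact hapos.ne' (by exact_mod_cast h)
      · exact S.root_ne (alpha_mem hκ j) h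
    have term : ∀ k ∈ Finset.Ico (1 : ℤ) a,
        (fun f => S.ev (S.wordOp l f) (x - (k : ℝ) • S.alpha j)) ∈
          S.Sp {z | dist z (S.geo hκ).o < dist lam (S.geo hκ).o} := by
      intro k hk
      rw [Finset.mem_Ico] at hk
      refine S.Sp_mono ?_ (expand hκ l _ (S.Plat_sub hx (alpha_mem hκ j) k).1)
      rintro η ⟨-, -, hη⟩
      refine convexHull_min (t := Metric.ball (S.geo hκ).o (dist lam (S.geo hκ).o)) ?_
        (convex_ball _ _) hη
      rintro y ⟨l', hl', rfl⟩
      have ha' : (0:ℝ) < a := by exact_mod_cast hapos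
      have hk0 : (0:ℝ) < k := by exact_mod_cast (by omega : 0 < k)
      have hka : (k:ℝ) < a := by exact_mod_cast hk.2
      have hz : x - (k : ℝ) • S.alpha j =
          (1 - (k:ℝ) / a) • x + ((k:ℝ) / a) • (S.geo hκ).s j x := by
        rw [hsx, smul_sub, smul_smul, div_mul_cancel₀ _ ha'.ne']; module
      rw [hz, (S.geo hκ).pt_aff l' _ _ _ _ (by ring)]
      have cb : ∀ z ∈ (S.geo hκ).D (j :: l) x,
          z ∈ Metric.closedBall (S.geo hκ).o (dist lam (S.geo hκ).o) := by
        intro z hz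
        rw [Metric.mem_closedBall]
        rcases hD hz with rfl | h
        · exact le_rfl
        · exact h.le
      apply combo_mem_ball_of_ne
        (cb _ ((S.geo hκ).D_cons_left l j x ⟨l', hl', rfl⟩))
        (cb _ ((S.geo hκ).D_cons_right l j x ⟨l', hl', rfl⟩))
      · intro h
        exact hne ((Equiv.injective _) h)
      · rw [sub_pos, div_lt_one ha']; exact hka
      · positivity
      · ring
    have hw : ∀ f, S.wordOp (j :: l) f = S.Top j (S.wordOp l f) := fun f => rfl
    have hsum := Submodule.sum_mem _ term
    have := Submodule.add_mem _ main
      (Submodule.smul_mem _ (1 - (S.t (S.alpha j) : ℂ)) hsum)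
    convert this using 1
    ext f
    rw [hw, Top_eq hκ j hx ha, if_pos hapos, ← Finset.Ico_insert_right (by omega : (1:ℤ) ≤ a),
      Finset.sum_insert (by simp)]
    simp only [Pi.add_apply, Pi.smul_apply, Finset.sum_apply, smul_eq_mul]
    ring

/-- delta function -/
def del (S : Setup V) (μ : V) : ↥S.Plat → ℂ := fun z => if z.1 = μ then 1 else 0

lemma ev_del (S : Setup V) {η μ : V} (hη : η ∈ S.Plat) :
    S.ev (S.del μ) η = if η = μ then 1 else 0 := by
  simp [ev, hη, del]

lemma Sp_zero (S : Setup V) {A : Set V} {F : (↥S.Plat → ℂ) → ℂ} (hF : F ∈ S.Sp A) {μ : V}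
    (hμ : μ ∉ A) : F (S.del μ) = 0 := by
  induction hF using Submodule.span_induction with
  | mem F hF =>
    obtain ⟨η, hη, rfl⟩ := hF
    have hne : η ≠ μ := fun h => hμ (h ▸ hη)
    by_cases hP : η ∈ S.Plat
    · simp only [E]; rw [ev_del S hP, if_neg hne]
    · simp [E, ev, hP]
  | zero => rfl
  | add a b _ _ ha hb => rw [Pi.add_apply, ha, hb, add_zero]
  | smul r a _ ha => rw [Pi.smul_apply, ha, smul_zero]

lemma Sp_eval (S : Setup V) {A : Set V} (hA : A.Finite) (hAP : A ⊆ S.Plat)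
    {F : (↥S.Plat → ℂ) → ℂ} (hF : F ∈ S.Sp A) (f : ↥S.Plat → ℂ) :
    F f = ∑ᶠ μ ∈ A, F (S.del μ) * S.ev f μ := by
  rw [finsum_mem_eq_finite_toFinset_sum _ hA]
  induction hF using Submodule.span_induction with
  | mem F hF =>
    obtain ⟨η, hη, rfl⟩ := hF
    rw [Finset.sum_eq_single η]
    · simp only [E]; rw [ev_del S (hAP hη), if_pos rfl, one_mul]
    · intro μ _ hne
      simp only [E]; rw [ev_del S (hAP hη), if_neg hne.symm, zero_mul]
    · intro h; exact absurd (hA.mem_toFinset.2 hη) h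
  | zero => simp
  | add a b _ _ ha hb => simp only [Pi.add_apply, ha, hb, add_mul, Finset.sum_add_distrib]
  | smul r a _ ha => simp only [Pi.smul_apply, smul_eq_mul, ha, Finset.mul_sum, mul_assoc]

end Setup


/-- triangularity of `𝒥` with respect to the partial order `⪯`:
`(𝒥 f)(λ) = ∑_{μ ⪯ λ} J_{λ,μ} f(μ)` with `J_{λ,λ} = t[λ]⁻¹`, the sets
`{μ ∈ P | μ ⪯ λ}` being finite. -/
theorem statement5 (S : Setup V) (htne : ∀ α ∈ S.R0, S.t α ≠ 0)
    (wmin : V → Equiv.Perm V) (hwmin : S.IsShortest wmin)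
    (TW : Equiv.Perm V → (↥S.Plat → ℂ) → (↥S.Plat → ℂ)) (hTW : S.IsTW TW) :
    ∃ Jc : V → V → ℂ,
      (∀ lam ∈ S.Plat, {μ : V | μ ∈ S.Plat ∧ S.preceq wmin μ lam}.Finite) ∧
      (∀ lam ∈ S.Plat, ∀ μ : V, Jc lam μ ≠ 0 → μ ∈ S.Plat ∧ S.preceq wmin μ lam) ∧
      (∀ (f : ↥S.Plat → ℂ) (lam : ↥S.Plat),
        S.JJ wmin TW f lam
          = ∑ᶠ μ ∈ {μ : V | μ ∈ S.Plat ∧ S.preceq wmin μ lam.1}, Jc lam.1 μ * S.ev f μ) ∧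
      (∀ lam ∈ S.Plat, Jc lam lam = (S.tBr lam)⁻¹) := by
  obtain ⟨κ, hκ⟩ := S.exists_kap
  have hfin : ∀ lam : V, {μ : V | μ ∈ S.Plat ∧ S.preceq wmin μ lam}.Finite := fun lam =>
    (S.Plat_finite (S.geo hκ).o (dist lam (S.geo hκ).o)).subset
      fun μ hμ => ⟨hμ.1, Setup.mem_of_preceq hκ hwmin hμ.2⟩
  have hSp : ∀ lam : ↥S.Plat, (fun f => S.JJ wmin TW f lam) ∈
      S.Sp {μ : V | μ ∈ S.Plat ∧ S.preceq wmin μ lam.1} := by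
    intro lam
    obtain ⟨l, hl⟩ := Setup.exists_reduced hκ (hwmin lam.1).1
    obtain ⟨hP, hQ⟩ := Setup.word_Plat hκ l lam.2
    rw [hl.1] at hP hQ
    simp only [Setup.JJ, hTW _ l hl]
    refine Submodule.smul_mem _ (S.tBr lam.1)⁻¹ (x := fun f => _)
      (S.Sp_mono ?_ (Setup.expand hκ l _ hP))
    rintro η ⟨h1, h2, h3⟩
    exact ⟨h1, Setup.preceq_of_mem hκ hwmin (S.Q_trans hQ h2)
      (convexHull_mono (Setup.D_subset_bra hκ hwmin hl) h3)⟩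
  refine ⟨fun lam μ => if h : lam ∈ S.Plat then S.JJ wmin TW (S.del μ) ⟨lam, h⟩ else 0,
    fun lam _ => hfin lam, ?_, ?_, ?_⟩
  · intro lam hlam μ hne
    simp only [hlam, dif_pos] at hne
    by_contra hn
    exact hne (S.Sp_zero (hSp ⟨lam, hlam⟩) hn)
  · intro f lam
    have := S.Sp_eval (hfin lam.1) (fun μ hμ => hμ.1) (hSp lam) f
    simp only [lam.2, dif_pos]
    exact this
  · intro lam hlam
    simp only [hlam, dif_pos]
    obtain ⟨l, hl⟩ := Setup.exists_reduced hκ (hwmin lam).1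
    obtain ⟨hP, hQ⟩ := Setup.word_Plat hκ l hlam
    rw [hl.1] at hP hQ
    have h1 := Setup.diag hκ lam l _ hP (Setup.SP_of_reduced hκ hwmin hl) (S.pt_eq hκ hl.1 lam)
      (Setup.D_subset_ball hκ hwmin hl)
    have h2 := S.Sp_zero h1 (μ := lam) (fun h => lt_irrefl (dist lam (S.geo hκ).o) h)
    rw [S.ev_del hlam, if_pos rfl, sub_eq_zero] at h2
    simp only [Setup.JJ, hTW _ l hl]
    rw [h2, mul_one]

end AffinePieri
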